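/- For all real numbers f_max > 0 and 0 < Δ₁ ≤ Δ₂ < ∞ there exists a constant c > 0, depending only on f_max, Δ₁ and Δ₂, with the following property. Let P ≥ 2 and n ≥ 1. Let (X̄_{1,m}(t))_{m∈[5], t∈[n]} and (X̄_{2,m}(t))_{m∈[5], t∈[n]} be two mutually independent families of random variables with values in {0, 1, …, ⌊√P⌋}, and let 𝒢 be a family of real random variables containing, for each k ∈ {1,2} and t ∈ [n], distinct coefficients g_{k,4}(t), g_{k,5}(t), g'_{k,1}(t), g'_{k,2}(t), g''_{k,3}(t), g''_{k,4}(t), g''_{k,5}(t), such that 𝒢 satisfies the (Δ₁, Δ₂, f_max)-bounded-density assumption and the pair of families (X̄_{1,·}, X̄_{2,·}) is jointly independent of 𝒢. For k ∈ {1,2} and t ∈ [n] define Ȳ_{1,k}(t) = ∑_{m=4}^{5} ⌊g_{k,m}(t)·X̄_{1,m}(t)⌋ + ∑_{m=1}^{2} ⌊g'_{k,m}(t)·(X̄_{2,m}(t))^{1}_{1/4}⌋ + ∑_{m=3}^{5} ⌊g''_{k,m}(t)·(X̄_{2,m}(t))^{1}_{1/2}⌋. Then 2·H( ((X̄_{2,m}(t))^{1}_{1/2})_{m∈{3,4,5},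 t∈[n]} ) ≤ 2·H( (Ȳ_{1,k}(t))_{k∈{1,2}, t∈[n]} | (X̄_{1,m}(t))_{m∈[5], t∈[n]}, 𝒢 ) + H( ((Ȳ_{1,k}(t))_{2/3})_{k∈{1,2}, t∈[n]} | ((Ȳ_{1,k}(t))^{1}_{2/3})_{k∈{1,2}, t∈[n]}, (X̄_{1,m}(t))_{m∈[5], t∈[n]}, 𝒢 ) + n·c·(1 + log(1 + log P)). -/

import Mathlib

open MeasureTheory ProbabilityTheory

noncomputable section

/-- Truncation of a real number toward zero. -/
def truncZ (x : ℝ) : ℤ := if 0 ≤ x then ⌊x⌋ else ⌈x⌉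

/-- `pbar P lam = ⌊P ^ (lam / 2)⌋`, i.e. `P̄^lam`. -/
def pbar (P lam : ℝ) : ℤ := ⌊P ^ (lam / 2)⌋

/-- The alphabet `𝒳_lam = {0, 1, …, P̄^lam − 1}`. -/
def Xalph (P lam : ℝ) : Set ℤ := {x : ℤ | 0 ≤ x ∧ x < pbar P lam}

/-- `(X)_lam = X − P̄^lam ⌊X / P̄^lam⌋` (division truncated toward zero). -/
def lowPart (P lam : ℝ) (X : ℤ) : ℤ := X - pbar P lam * (X.tdiv (pbar P lam))

/-- `(X)^hi_lo = ⌊(X − P̄^hi ⌊X / P̄^hi⌋) / P̄^lo⌋` (divisions truncated toward zero). -/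
def midPart (P lo hi : ℝ) (X : ℤ) : ℤ := (lowPart P hi X).tdiv (pbar P lo)

/-- Shannon entropy (natural log) of a random variable with (essentially) finite range. -/
def shEntropy {Ω : Type*} [MeasurableSpace Ω] (μ : Measure Ω) {α : Type*} (X : Ω → α) : ℝ :=
  ∑' a : α, Real.negMulLog (μ (X ⁻¹' {a})).toReal

/-- Conditional Shannon entropy `H(X | Y)`, defined through conditional expectations of
indicators with respect to the σ-algebra generated by `Y`. -/
def shCondEntropy {Ω : Type*} [MeasurableSpace Ω] (μ : Measure Ω) {α β : Type*}
    [MeasurableSpace β] (X : Ω → α) (Y : Ω → β) : ℝ :=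
  ∫ ω, ∑' a : α,
    Real.negMulLog
      ((μ[Set.indicator (X ⁻¹' {a}) (fun _ => (1 : ℝ)) | MeasurableSpace.comap Y inferInstance]) ω)
    ∂μ

/-- `X` and `Y` are conditionally independent given `W`. -/
def CondIndepGiven {Ω α β γ : Type*} [MeasurableSpace Ω] [MeasurableSpace α] [MeasurableSpace β]
    [MeasurableSpace γ] (μ : Measure Ω) (W : Ω → γ) (X : Ω → α) (Y : Ω → β) : Prop :=
  ∀ (A : Set α) (B : Set β), MeasurableSet A → MeasurableSet B →
    (μ[Set.indicator (X ⁻¹' A ∩ Y ⁻¹' B) (fun _ => (1 : ℝ)) |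
        MeasurableSpace.comap W inferInstance])
      =ᵐ[μ]
      fun ω =>
        (μ[Set.indicator (X ⁻¹' A) (fun _ => (1 : ℝ)) | MeasurableSpace.comap W inferInstance]) ω *
        (μ[Set.indicator (Y ⁻¹' B) (fun _ => (1 : ℝ)) | MeasurableSpace.comap W inferInstance]) ω

/-- The conditional distribution of `g` given `V` is a.s. absolutely continuous with
density bounded above by `fmax`: equivalently, the conditional probability of any
measurable set `S` is a.s. at most `fmax · volume S`. -/
def CondDensityBounded {Ω β : Type*} [MeasurableSpace Ω] [MeasurableSpace β]
    (μ : Measure Ω) (g : Ω → ℝ) (V : Ω → β) (fmax : ℝ) : Prop :=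
  ∀ S : Set ℝ, MeasurableSet S →
    ∀ᵐ ω ∂μ,
      ENNReal.ofReal
          ((μ[Set.indicator (g ⁻¹' S) (fun _ => (1 : ℝ)) |
              MeasurableSpace.comap V inferInstance]) ω)
        ≤ ENNReal.ofReal fmax * volume S

/-- Density part of the bounded-density assumption for a family `g`, conditioned on a
random variable `W`: for disjoint subfamilies `s, t`, the conditional joint distribution of
`(g i)_{i ∈ s}` given `(W, (g j)_{j ∈ t})` is a.s. absolutely continuous with joint density
bounded above by `fmax ^ |s|`. -/
def CondBoundedDensityFamily {Ω ι γ : Type*} [MeasurableSpace Ω] [MeasurableSpace γ]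
    [DecidableEq ι] (μ : Measure Ω) (W : Ω → γ) (g : ι → Ω → ℝ) (fmax : ℝ) : Prop :=
  ∀ (s t : Finset ι), s.Nonempty → Disjoint s t →
    ∀ S : Set (s → ℝ), MeasurableSet S →
      ∀ᵐ ω ∂μ,
        ENNReal.ofReal
            ((μ[Set.indicator ((fun ω (i : s) => g i ω) ⁻¹' S) (fun _ => (1 : ℝ)) |
                MeasurableSpace.comap (fun ω => (W ω, fun j : t => g j ω)) inferInstance]) ω)
          ≤ ENNReal.ofReal (fmax ^ s.card) * volume S

/-- The `(Δ₁, Δ₂, fmax)`-bounded-density assumption for a family `g` of real random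
variables (Definition 4 of the paper). -/
def BoundedDensityFamily {Ω ι : Type*} [MeasurableSpace Ω] [DecidableEq ι]
    (μ : Measure Ω) (g : ι → Ω → ℝ) (Δ₁ Δ₂ fmax : ℝ) : Prop :=
  (∀ i, ∀ᵐ ω ∂μ, Δ₁ ≤ |g i ω| ∧ |g i ω| ≤ Δ₂) ∧
  ∀ (s t : Finset ι), s.Nonempty → Disjoint s t →
    ∀ S : Set (s → ℝ), MeasurableSet S →
      ∀ᵐ ω ∂μ,
        ENNReal.ofReal
            ((μ[Set.indicator ((fun ω (i : s) => g i ω) ⁻¹' S) (fun _ => (1 : ℝ)) |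
                MeasurableSpace.comap (fun ω (j : t) => g j ω) inferInstance]) ω)
          ≤ ENNReal.ofReal (fmax ^ s.card) * volume S

/-- Partial sums `Λ_i = λ₁ + ⋯ + λ_i` of the power levels (0-based: `cumSum lam i`
sums the first `i` entries). -/
def cumSum {M : ℕ} (lam : Fin M → ℝ) (i : ℕ) : ℝ :=
  ∑ r ∈ Finset.univ.filter (fun r : Fin M => (r : ℕ) < i), lam r

end

/-! ## Finite entropies -/

open Classical in
/-- mass of the fibre of `f` through `x` -/
noncomputable def S9.mass {X α : Type*} [Fintype X] (p : X → ℝ) (f : X → α) (x : X) : ℝ :=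
  ∑ x', if f x' = f x then p x' else 0

/-- finite entropy of `f` under the weights `p` -/
noncomputable def S9.Ent {X α : Type*} [Fintype X] (p : X → ℝ) (f : X → α) : ℝ :=
  ∑ x, p x * (-Real.log (S9.mass p f x))

theorem S9.mass_eq {X α : Type*} [Fintype X] [DecidableEq α] (p : X → ℝ) (f : X → α) (x : X) :
    S9.mass p f x = ∑ y ∈ Finset.univ.filter (fun y => f y = f x), p y := by
  unfold S9.mass
  rw [Finset.sum_filter]
  refine Finset.sum_congr rfl fun y _ => ?_
  congr

theorem S9.mass_nonneg {X α : Type*} [Fintype X] {p : X → ℝ} (hp : ∀ x, 0 ≤ p x) (f : X → α)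
    (x : X) : 0 ≤ S9.mass p f x := by
  unfold S9.mass
  exact Finset.sum_nonneg fun y _ => by split_ifs <;> simp [hp]

theorem S9.mass_congr {X α : Type*} [Fintype X] (p : X → ℝ) (f : X → α)
    {x y : X} (h : f x = f y) : S9.mass p f x = S9.mass p f y := by
  unfold S9.mass
  rw [h]

theorem S9.mass_mono {X α β : Type*} [Fintype X] {p : X → ℝ} (hp : ∀ x, 0 ≤ p x) (f : X → α)
    (g : X → β) (x : X) (h : ∀ y, f y = f x → g y = g x) : S9.mass p f x ≤ S9.mass p g x := by
  classical
  unfold S9.mass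
  refine Finset.sum_le_sum fun y _ => ?_
  by_cases hy : f y = f x
  · simp [hy, h y hy]
  · rw [if_neg hy]
    split_ifs <;> simp [hp]

theorem S9.le_mass {X α : Type*} [Fintype X] {p : X → ℝ} (hp : ∀ x, 0 ≤ p x) (f : X → α)
    (x : X) : p x ≤ S9.mass p f x := by
  classical
  unfold S9.mass
  have := Finset.single_le_sum (f := fun y => if f y = f x then p y else 0)
    (fun y _ => by split_ifs <;> simp [hp]) (Finset.mem_univ x)
  simpa using this

theorem S9.mass_pos {X α : Type*} [Fintype X] {p : X → ℝ} (hp : ∀ x, 0 ≤ p x) (f : X → α)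
    {x : X} (hx : p x ≠ 0) : 0 < S9.mass p f x :=
  lt_of_lt_of_le (lt_of_le_of_ne (hp x) (Ne.symm hx)) (S9.le_mass hp f x)

theorem S9.gibbs {X : Type*} [Fintype X] {p : X → ℝ} (hp : ∀ x, 0 ≤ p x) (h1 : ∑ x, p x = 1)
    (r : X → ℝ) (hr : ∀ x, p x ≠ 0 → 0 < r x) (K : ℝ) (hK : 0 < K) :
    ∑ x, p x * Real.log (r x) ≤ Real.log K - 1 + (∑ x, p x * r x) / K := by
  have h : ∀ x, p x * Real.log (r x) ≤ p x * (Real.log K - 1) + p x * r x / K := by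
    intro x
    by_cases hx : p x = 0
    · simp [hx]
    · have h2 := hr x hx
      have h3 := Real.log_le_sub_one_of_pos (div_pos h2 hK)
      rw [Real.log_div h2.ne' hK.ne'] at h3
      have : Real.log (r x) ≤ (Real.log K - 1) + r x / K := by linarith
      calc _ ≤ p x * ((Real.log K - 1) + r x / K) := mul_le_mul_of_nonneg_left this (hp x)
        _ = _ := by ring
  calc _ ≤ ∑ x, (p x * (Real.log K - 1) + p x * r x / K) := Finset.sum_le_sum fun x _ => h x
    _ = _ := by
      rw [Finset.sum_add_distrib, ← Finset.sum_mul, h1, ← Finset.sum_div]; ring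

theorem S9.sum_div_mass {X α : Type*} [Fintype X] [DecidableEq α] {p : X → ℝ} (hp : ∀ x, 0 ≤ p x) (f : X → α)
    (A : Finset X) (F : α → ℝ) (hF : ∀ a, 0 ≤ F a) :
    ∑ x ∈ A, p x / S9.mass p f x * F (f x) ≤ ∑ a ∈ A.image f, F a := by
  classical
  rw [← Finset.sum_fiberwise_of_maps_to (g := f) (t := A.image f)
    (fun x hx => Finset.mem_image_of_mem f hx)]
  refine Finset.sum_le_sum fun a ha => ?_
  obtain ⟨x0, hx0, rfl⟩ := Finset.mem_image.1 ha
  have : ∀ x ∈ A.filter (fun x => f x = f x0), p x / S9.mass p f x * F (f x)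
      = p x * (F (f x0) / S9.mass p f x0) := by
    intro x hx
    have hx := (Finset.mem_filter.1 hx).2
    rw [S9.mass_congr p f hx, hx]; ring
  rw [Finset.sum_congr rfl this, ← Finset.sum_mul]
  have h2 : ∑ x ∈ A.filter (fun x => f x = f x0), p x ≤ S9.mass p f x0 := by
    rw [S9.mass_eq]
    exact Finset.sum_le_sum_of_subset_of_nonneg
      (Finset.filter_subset_filter _ (Finset.subset_univ A)) fun x _ _ => hp x
  have h3 := S9.mass_nonneg hp f x0
  calc _ ≤ S9.mass p f x0 * (F (f x0) / S9.mass p f x0) :=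
        mul_le_mul_of_nonneg_right h2 (div_nonneg (hF _) h3)
    _ ≤ F (f x0) := by
      by_cases h : S9.mass p f x0 = 0
      · simp [h, hF]
      · exact (mul_div_cancel₀ _ h).le

theorem S9.Ent_mono {X α β : Type*} [Fintype X] {p : X → ℝ} (hp : ∀ x, 0 ≤ p x) (f : X → α)
    (g : X → β) (h : ∀ x y, f y = f x → g y = g x) : S9.Ent p g ≤ S9.Ent p f := by
  unfold S9.Ent
  refine Finset.sum_le_sum fun x _ => ?_
  by_cases hx : p x = 0
  · simp [hx]
  refine mul_le_mul_of_nonneg_left ?_ (hp x)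
  have := Real.log_le_log (S9.mass_pos hp f hx) (S9.mass_mono hp f g x (h x))
  linarith

/-- few values of `m` for every value of `d` -/
theorem S9.Ent_le_add_log {X α β : Type*} [Fintype X] {p : X → ℝ} (hp : ∀ x, 0 ≤ p x)
    (h1 : ∑ x, p x = 1) (m : X → α) (d : X → β) (C : ℝ) (hC : 0 < C)
    (h : ∀ x0, ∃ T : Finset α, (∀ x, d x = d x0 → m x ∈ T) ∧ (T.card : ℝ) ≤ C) :
    S9.Ent p m ≤ S9.Ent p d + Real.log C := by
  classical
  have hg := S9.gibbs hp h1 (fun x => S9.mass p d x / S9.mass p m x)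
    (fun x hx => div_pos (S9.mass_pos hp _ hx) (S9.mass_pos hp _ hx)) C hC
  have e : ∑ x, p x * Real.log (S9.mass p d x / S9.mass p m x) = S9.Ent p m - S9.Ent p d := by
    unfold S9.Ent
    rw [← Finset.sum_sub_distrib]
    refine Finset.sum_congr rfl fun x _ => ?_
    by_cases hx : p x = 0
    · simp [hx]
    rw [Real.log_div (S9.mass_pos hp _ hx).ne' (S9.mass_pos hp _ hx).ne']; ring
  have hb : ∑ x, p x * (S9.mass p d x / S9.mass p m x) ≤ C := by
    calc ∑ x, p x * (S9.mass p d x / S9.mass p m x)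
        = ∑ x, ∑ y, p y * (if d y = d x then p x / S9.mass p m x else 0) := by
          refine Finset.sum_congr rfl fun x _ => ?_
          rw [mul_div_assoc', mul_comm, mul_div_assoc]
          conv_lhs => unfold S9.mass
          rw [Finset.sum_mul]
          refine Finset.sum_congr rfl fun y _ => ?_
          unfold S9.mass
          split_ifs <;> simp
      _ = ∑ y, p y * ∑ x ∈ Finset.univ.filter (fun x => d x = d y), p x / S9.mass p m x := by
          rw [Finset.sum_comm]
          refine Finset.sum_congr rfl fun y _ => ?_
          rw [← Finset.mul_sum, Finset.sum_filter]
          congr 1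
          refine Finset.sum_congr rfl fun x _ => ?_
          simp only [eq_comm]
      _ ≤ ∑ y, p y * C := by
          refine Finset.sum_le_sum fun y _ => mul_le_mul_of_nonneg_left ?_ (hp y)
          obtain ⟨T, hT, hTC⟩ := h y
          have := S9.sum_div_mass hp m (Finset.univ.filter (fun x => d x = d y)) (fun _ => 1)
            (fun _ => zero_le_one)
          simp only [mul_one, Finset.sum_const, nsmul_eq_mul] at this
          refine this.trans (le_trans ?_ hTC)
          norm_cast
          refine Finset.card_le_card fun a ha => ?_
          obtain ⟨x, hx, rfl⟩ := Finset.mem_image.1 ha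
          exact hT x (Finset.mem_filter.1 hx).2
      _ = C := by rw [← Finset.sum_mul, h1, one_mul]
  have : (∑ x, p x * (S9.mass p d x / S9.mass p m x)) / C ≤ 1 := (div_le_one hC).2 hb
  linarith

theorem S9.Ent_submod {X α β γ : Type*} [Fintype X] {p : X → ℝ} (hp : ∀ x, 0 ≤ p x)
    (h1 : ∑ x, p x = 1) (s : X → α) (b : X → β) (c : X → γ) :
    S9.Ent p s + S9.Ent p (fun x => (s x, b x, c x))
      ≤ S9.Ent p (fun x => (s x, b x)) + S9.Ent p (fun x => (s x, c x)) := by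
  classical
  set sb := fun x => (s x, b x) with hsb
  set sc := fun x => (s x, c x) with hsc
  set sbc := fun x => (s x, b x, c x) with hsbc
  have hg := S9.gibbs hp h1
    (fun x => (S9.mass p sb x * S9.mass p sc x) / (S9.mass p s x * S9.mass p sbc x))
    (fun x hx => div_pos (mul_pos (S9.mass_pos hp _ hx) (S9.mass_pos hp _ hx))
      (mul_pos (S9.mass_pos hp _ hx) (S9.mass_pos hp _ hx))) 1 one_pos
  have e : ∑ x, p x * Real.log
      ((S9.mass p sb x * S9.mass p sc x) / (S9.mass p s x * S9.mass p sbc x))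
      = S9.Ent p s + S9.Ent p sbc - (S9.Ent p sb + S9.Ent p sc) := by
    unfold S9.Ent
    rw [← Finset.sum_add_distrib, ← Finset.sum_add_distrib, ← Finset.sum_sub_distrib]
    refine Finset.sum_congr rfl fun x _ => ?_
    by_cases hx : p x = 0
    · simp [hx]
    have a1 := (S9.mass_pos hp sb hx).ne'
    have a2 := (S9.mass_pos hp sc hx).ne'
    have a3 := (S9.mass_pos hp s hx).ne'
    have a4 := (S9.mass_pos hp sbc hx).ne'
    rw [Real.log_div (mul_ne_zero a1 a2) (mul_ne_zero a3 a4), Real.log_mul a1 a2,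
      Real.log_mul a3 a4]; ring
  have hb : ∑ x, p x * ((S9.mass p sb x * S9.mass p sc x) / (S9.mass p s x * S9.mass p sbc x))
      ≤ 1 := by
    calc ∑ x, p x * ((S9.mass p sb x * S9.mass p sc x) / (S9.mass p s x * S9.mass p sbc x))
        = ∑ x, ∑ y, ∑ z, p y * p z * (if sb y = sb x ∧ sc z = sc x then
            p x / S9.mass p sbc x / S9.mass p s x else 0) := by
          refine Finset.sum_congr rfl fun x _ => ?_
          have : p x * ((S9.mass p sb x * S9.mass p sc x) / (S9.mass p s x * S9.mass p sbc x))
            = S9.mass p sb x * (S9.mass p sc x * (p x / S9.mass p sbc x / S9.mass p s x)) := by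
            rw [div_div, mul_comm (S9.mass p sbc x)]; ring
          rw [this]
          generalize p x / S9.mass p sbc x / S9.mass p s x = u
          unfold S9.mass
          rw [Finset.sum_mul]
          refine Finset.sum_congr rfl fun y _ => ?_
          rw [Finset.sum_mul, Finset.mul_sum]
          refine Finset.sum_congr rfl fun z _ => ?_
          by_cases h1 : sb y = sb x <;> by_cases h2 : sc z = sc x <;> simp [h1, h2]
          ring
      _ = ∑ y, ∑ z, p y * p z * ∑ x, (if sb y = sb x ∧ sc z = sc x then
            p x / S9.mass p sbc x / S9.mass p s x else 0) := by
          rw [Finset.sum_comm]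
          refine Finset.sum_congr rfl fun y _ => ?_
          rw [Finset.sum_comm]
          refine Finset.sum_congr rfl fun z _ => ?_
          rw [Finset.mul_sum]
      _ ≤ ∑ y, ∑ z, p y * p z * (if s z = s y then 1 / S9.mass p s y else 0) := by
          refine Finset.sum_le_sum fun y _ => Finset.sum_le_sum fun z _ =>
            mul_le_mul_of_nonneg_left ?_ (mul_nonneg (hp y) (hp z))
          rw [← Finset.sum_filter]
          by_cases hsz : s z = s y
          · rw [if_pos hsz]
            have h3 := S9.sum_div_mass hp sbc
              (Finset.univ.filter (fun x => sb y = sb x ∧ sc z = sc x)) (fun _ => 1)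
              (fun _ => zero_le_one)
            simp only [mul_one, Finset.sum_const, nsmul_eq_mul] at h3
            have h4 : ((Finset.univ.filter (fun x => sb y = sb x ∧ sc z = sc x)).image sbc).card
                ≤ 1 := by
              rw [Finset.card_le_one]
              intro a ha a' ha'
              obtain ⟨x, hx, rfl⟩ := Finset.mem_image.1 ha
              obtain ⟨x', hx', rfl⟩ := Finset.mem_image.1 ha'
              have hx := (Finset.mem_filter.1 hx).2
              have hx' := (Finset.mem_filter.1 hx').2
              simp only [hsb, hsc, hsbc, Prod.mk.injEq] at hx hx' ⊢
              refine ⟨hx.1.1.symm.trans hx'.1.1, hx.1.2.symm.trans hx'.1.2,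
                hx.2.2.symm.trans hx'.2.2⟩
            have h5 : (((Finset.univ.filter (fun x => sb y = sb x ∧ sc z = sc x)).image sbc).card
                : ℝ) ≤ 1 := by exact_mod_cast h4
            have h6 : ∀ x ∈ Finset.univ.filter (fun x => sb y = sb x ∧ sc z = sc x),
                p x / S9.mass p sbc x / S9.mass p s x
                  = p x / S9.mass p sbc x / S9.mass p s y := by
              intro x hx
              have hx := (Finset.mem_filter.1 hx).2.1
              simp only [hsb, Prod.mk.injEq] at hx
              rw [S9.mass_congr p s hx.1]
            rw [Finset.sum_congr rfl h6, ← Finset.sum_div]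
            exact div_le_div_of_nonneg_right (h3.trans h5) (S9.mass_nonneg hp s y)
          · rw [if_neg hsz, Finset.filter_false_of_mem]
            · simp
            · rintro x - ⟨hx, hx'⟩
              simp only [hsb, hsc, Prod.mk.injEq] at hx hx'
              exact hsz (hx'.1.trans hx.1.symm)
      _ = ∑ y, p y * (S9.mass p s y * (1 / S9.mass p s y)) := by
          refine Finset.sum_congr rfl fun y _ => ?_
          generalize 1 / S9.mass p s y = u
          unfold S9.mass
          rw [Finset.sum_mul, Finset.mul_sum]
          refine Finset.sum_congr rfl fun z _ => ?_
          split_ifs <;> ring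
      _ ≤ ∑ y, p y := by
          refine Finset.sum_le_sum fun y _ => ?_
          have : S9.mass p s y * (1 / S9.mass p s y) ≤ 1 := by
            rw [mul_one_div]; exact div_self_le_one _
          calc _ ≤ p y * 1 := mul_le_mul_of_nonneg_left this (hp y)
            _ = _ := mul_one _
      _ = 1 := h1
  simp only [Real.log_one, div_one] at hg
  linarith
/-! ## From conditional expectations to finite entropies -/

open Classical in
/-- conditional average of `u` given `m` -/
noncomputable def S9.cavg {X β : Type*} [Fintype X] (p : X → ℝ) (m : X → β) (u : X → ℝ) (x : X) :
    ℝ :=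
  (∑ y, if m y = m x then p y * u y else 0) / S9.mass p m x

theorem S9.sum_cavg {X β : Type*} [Fintype X] {p : X → ℝ} (hp : ∀ x, 0 ≤ p x) (m : X → β)
    (u : X → ℝ) (c : β → ℝ) :
    ∑ x, p x * (c (m x) * S9.cavg p m u x) = ∑ x, p x * (c (m x) * u x) := by
  classical
  calc ∑ x, p x * (c (m x) * S9.cavg p m u x)
      = ∑ x, ∑ y, (if m x = m y then p x else 0) * (p y * u y * (c (m y) / S9.mass p m y)) := by
        refine Finset.sum_congr rfl fun x _ => ?_
        unfold S9.cavg
        rw [div_eq_mul_inv, Finset.sum_mul, Finset.mul_sum, Finset.mul_sum]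
        refine Finset.sum_congr rfl fun y _ => ?_
        by_cases h : m x = m y
        · rw [if_pos h, if_pos h.symm, S9.mass_congr p m h, h]; ring
        · rw [if_neg h, if_neg (Ne.symm h)]; ring
    _ = ∑ y, S9.mass p m y * (p y * u y * (c (m y) / S9.mass p m y)) := by
        rw [Finset.sum_comm]
        refine Finset.sum_congr rfl fun y _ => ?_
        rw [← Finset.sum_mul]; rfl
    _ = _ := by
        refine Finset.sum_congr rfl fun y _ => ?_
        by_cases hy : p y = 0
        · simp [hy]
        · have := (S9.mass_pos hp m hy).ne'
          field_simp

open Classical in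
theorem S9.tsum_negMulLog {X α β : Type*} [Fintype X] (p : X → ℝ)
    (l : X → α) (m : X → β) (x : X) :
    ∑' a : α, Real.negMulLog (S9.cavg p m (fun y => if l y = a then 1 else 0) x)
      = S9.cavg p m (fun y => -Real.log (S9.mass p (fun z => (l z, m z)) y / S9.mass p m y)) x := by
  rw [tsum_eq_sum (s := Finset.univ.image l)]
  · have key : ∀ a, Real.negMulLog (S9.cavg p m (fun y => if l y = a then 1 else 0) x)
        = ∑ y, if l y = a then (if m y = m x then
          p y * -Real.log (S9.mass p (fun z => (l z, m z)) y / S9.mass p m y) else 0)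
            / S9.mass p m x else 0 := by
      intro a
      have e : Real.negMulLog (S9.cavg p m (fun y => if l y = a then 1 else 0) x)
        = S9.cavg p m (fun y => if l y = a then 1 else 0) x *
          -Real.log (S9.cavg p m (fun y => if l y = a then 1 else 0) x) := by
        rw [Real.negMulLog]; ring
      rw [e]
      conv_lhs => enter [1]; unfold S9.cavg
      rw [Finset.sum_div, Finset.sum_mul]
      refine Finset.sum_congr rfl fun y _ => ?_
      by_cases h1 : l y = a <;> by_cases h2 : m y = m x
      · simp only [h1, h2, if_true]
        have : S9.cavg p m (fun y => if l y = a then 1 else 0) x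
            = S9.mass p (fun z => (l z, m z)) y / S9.mass p m y := by
          rw [S9.mass_congr p m h2]
          unfold S9.cavg
          congr 1
          unfold S9.mass
          refine Finset.sum_congr rfl fun z _ => ?_
          by_cases h3 : m z = m x <;> by_cases h4 : l z = a <;> simp [h1, h2, h3, h4]
        rw [this]; ring
      · simp [h2]
      · simp [h1]
      · simp [h1]
    simp_rw [key]
    rw [Finset.sum_comm]
    conv_rhs => unfold S9.cavg
    rw [Finset.sum_div]
    refine Finset.sum_congr rfl fun y _ => ?_
    rw [Finset.sum_ite_eq, if_pos (Finset.mem_image_of_mem l (Finset.mem_univ y))]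
  · intro a ha
    have : S9.cavg p m (fun y => if l y = a then 1 else 0) x = 0 := by
      unfold S9.cavg
      rw [Finset.sum_eq_zero, zero_div]
      intro y _
      have : l y ≠ a := by
        rintro rfl
        exact ha (Finset.mem_image_of_mem l (Finset.mem_univ y))
      simp [this]
    rw [this]; simp

/-- a function factoring through a measurable map to a finite type is integrable -/
theorem S9.integrable_of_factor {Ω T : Type*} [MeasurableSpace Ω] (μ : Measure Ω)
    [IsFiniteMeasure μ] [Finite T] [MeasurableSpace T] [MeasurableSingletonClass T]
    (e : Ω → T) (he : Measurable e) (φ : Ω → ℝ) (h : Function.FactorsThrough φ e) :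
    Measurable φ ∧ Integrable φ μ := by
  have e1 : φ = (Function.extend e φ (0 : T → ℝ)) ∘ e := (h.extend_comp (0 : T → ℝ)).symm
  have hm : Measurable φ := by
    rw [e1]; exact Measurable.of_discrete.comp he
  refine ⟨hm, ?_⟩
  obtain ⟨C, hC⟩ := (Set.finite_range (fun t => ‖Function.extend e φ (0 : T → ℝ) t‖)).bddAbove
  refine Integrable.of_bound hm.aestronglyMeasurable C (Filter.Eventually.of_forall fun ω => ?_)
  rw [e1]
  exact hC ⟨e ω, rfl⟩

theorem S9.integral_indep {Ω X 𝒲 : Type*} [MeasurableSpace Ω] (μ : Measure Ω)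
    [IsProbabilityMeasure μ] [Fintype X] [MeasurableSpace X] [MeasurableSingletonClass X]
    [MeasurableSpace 𝒲] (V : Ω → X) (W : Ω → 𝒲) (hV : Measurable V) (_hW : Measurable W)
    (hI : IndepFun V W μ) (φ : X → 𝒲 → ℝ) (hφ : ∀ x, Measurable (φ x))
    (hi : ∀ x, Integrable (fun ω => φ x (W ω)) μ) :
    ∫ ω, φ (V ω) (W ω) ∂μ = ∫ ω, ∑ x, μ.real (V ⁻¹' {x}) * φ x (W ω) ∂μ := by
  classical
  have e : ∀ ω, φ (V ω) (W ω) = ∑ x, (if V ω = x then (1 : ℝ) else 0) * φ x (W ω) := by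
    intro ω; simp
  have hm : ∀ x : X, Measurable (fun v : X => if v = x then (1 : ℝ) else 0) :=
    fun x => Measurable.of_discrete
  have hmi : ∀ x : X, Integrable (fun ω => if V ω = x then (1 : ℝ) else 0) μ := fun x =>
    Integrable.of_bound ((hm x).comp hV).aestronglyMeasurable 1
      (Filter.Eventually.of_forall fun ω => by split_ifs <;> simp)
  have hind : ∀ x, IndepFun (fun ω => if V ω = x then (1 : ℝ) else 0) (fun ω => φ x (W ω)) μ :=
    fun x => hI.comp (hm x) (hφ x)
  simp_rw [e]
  have hprod : ∀ x, Integrable (fun ω => (if V ω = x then (1 : ℝ) else 0) * φ x (W ω)) μ :=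
    fun x => (hind x).integrable_mul (hmi x) (hi x)
  rw [integral_finsetSum _ (fun x _ => hprod x),
    integral_finsetSum _ (fun x _ => (hi x).const_mul _)]
  refine Finset.sum_congr rfl fun x _ => ?_
  rw [(hind x).integral_fun_mul_eq_mul_integral (hmi x).aestronglyMeasurable
    (hi x).aestronglyMeasurable, integral_const_mul]
  congr 1
  have : (fun ω => if V ω = x then (1 : ℝ) else 0) = (V ⁻¹' {x}).indicator 1 := by
    ext ω; simp [Set.indicator]
  rw [this, integral_indicator_one (hV (measurableSet_singleton x))]
theorem S9.mass_kernel {X α β : Type*} [Fintype X] (p : X → ℝ) (f : X → α) (g : X → β)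
    (h : ∀ x y, f y = f x ↔ g y = g x) : S9.mass p f = S9.mass p g := by
  ext x
  unfold S9.mass
  refine Finset.sum_congr rfl fun y _ => ?_
  by_cases hh : f y = f x
  · rw [if_pos hh, if_pos ((h x y).1 hh)]
  · rw [if_neg hh, if_neg (fun h' => hh ((h x y).2 h'))]

theorem S9.measurable_curry {Ω X 𝒲 γ : Type*} [MeasurableSpace Ω] [Fintype X]
    [MeasurableSpace X] [MeasurableSingletonClass X] [MeasurableSpace 𝒲] [MeasurableSpace γ]
    (V : Ω → X) (W : Ω → 𝒲) (hV : Measurable V) (hW : Measurable W)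
    (f : X → 𝒲 → γ) (hf : ∀ x, Measurable (f x)) : Measurable (fun ω => f (V ω) (W ω)) := by
  have : Measurable (fun q : X × 𝒲 => f q.1 q.2) := measurable_from_prod_countable_right hf
  exact this.comp (hV.prodMk hW)

theorem S9.measurable_pattern {X 𝒲 α : Type*} [MeasurableSpace 𝒲]
    [MeasurableSpace α] [Countable α] [MeasurableSingletonClass α]
    (l : X → 𝒲 → α) (hl : ∀ x, Measurable (l x)) :
    Measurable (fun (w : 𝒲) (x y : X) => (l y w = l x w)) := by
  refine measurable_pi_lambda _ fun x => measurable_pi_lambda _ fun y => ?_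
  exact measurableSet_setOfPred.1 (measurableSet_eq_fun (hl y) (hl x))

theorem S9.integrable_Ent {Ω X 𝒲 α : Type*} [MeasurableSpace Ω] (μ : Measure Ω)
    [IsProbabilityMeasure μ] [Fintype X] [MeasurableSpace 𝒲]
    [MeasurableSpace α] [Countable α] [MeasurableSingletonClass α]
    (p : X → ℝ) (W : Ω → 𝒲) (hW : Measurable W) (l : X → 𝒲 → α) (hl : ∀ x, Measurable (l x)) :
    Integrable (fun ω => S9.Ent p (fun x => l x (W ω))) μ := by
  refine (S9.integrable_of_factor μ (fun ω (x y : X) => (l y (W ω) = l x (W ω)))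
    ((S9.measurable_pattern l hl).comp hW) _ ?_).2
  intro ω ω' h
  unfold S9.Ent
  dsimp only
  rw [S9.mass_kernel p (fun x => l x (W ω)) (fun x => l x (W ω'))]
  intro x y
  exact iff_of_eq (congrFun (congrFun h x) y)

open Classical in
theorem S9.condExp_eq {Ω X 𝒲 α β : Type*} [mΩ : MeasurableSpace Ω] (μ : Measure Ω)
    [IsProbabilityMeasure μ] [Fintype X] [MeasurableSpace X] [MeasurableSingletonClass X]
    [MeasurableSpace 𝒲] (V : Ω → X) (W : Ω → 𝒲) (hV : Measurable V) (hW : Measurable W)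
    (hI : IndepFun V W μ)
    [MeasurableSpace α] [MeasurableSingletonClass α]
    [MeasurableSpace β] [Countable β] [MeasurableSingletonClass β]
    (l : X → 𝒲 → α) (hl : ∀ x, Measurable (l x)) (m : X → 𝒲 → β) (hm : ∀ x, Measurable (m x))
    (a : α) :
    (μ[Set.indicator ((fun ω => l (V ω) (W ω)) ⁻¹' {a}) (fun _ => (1 : ℝ)) |
      MeasurableSpace.comap (fun ω => (m (V ω) (W ω), W ω)) inferInstance]) =ᵐ[μ]
    fun ω => S9.cavg (fun x => μ.real (V ⁻¹' {x})) (fun x => m x (W ω))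
      (fun y => if l y (W ω) = a then 1 else 0) (V ω) := by
  set p : X → ℝ := fun x => μ.real (V ⁻¹' {x}) with hpdef
  have hp : ∀ x, 0 ≤ p x := fun x => measureReal_nonneg
  have hMm : Measurable (fun ω => (m (V ω) (W ω), W ω)) := (S9.measurable_curry V W hV hW m hm).prodMk hW
  have hLm : Measurable (fun ω => l (V ω) (W ω)) := S9.measurable_curry V W hV hW l hl
  set R : β × 𝒲 → ℝ := fun q =>
    (∑ y, if m y q.2 = q.1 then p y * (if l y q.2 = a then 1 else 0) else 0) /
      (∑ y, if m y q.2 = q.1 then p y else 0) with hR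
  have hRe : ∀ x w, S9.cavg p (fun x => m x w) (fun y => if l y w = a then 1 else 0) x
      = R (m x w, w) := fun x w => rfl
  have hs1 : ∀ y, MeasurableSet {q : β × 𝒲 | m y q.2 = q.1} := fun y =>
    measurableSet_eq_fun ((hm y).comp measurable_snd) measurable_fst
  have hs2 : ∀ y, MeasurableSet {q : β × 𝒲 | l y q.2 = a} := fun y =>
    ((hl y).comp measurable_snd) (measurableSet_singleton a)
  have hRm : Measurable R := by
    refine Measurable.div ?_ ?_
    · refine Finset.measurable_sum _ fun y _ => ?_
      exact Measurable.ite (hs1 y) ((Measurable.ite (hs2 y) measurable_const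
        measurable_const).const_mul _) measurable_const
    · refine Finset.measurable_sum _ fun y _ => ?_
      exact Measurable.ite (hs1 y) measurable_const measurable_const
  have hRb : ∀ q, ‖R q‖ ≤ 1 := by
    intro q
    have h1 : 0 ≤ ∑ y, if m y q.2 = q.1 then p y * (if l y q.2 = a then 1 else 0) else 0 :=
      Finset.sum_nonneg fun y _ => by split_ifs <;> simp [hp]
    have h2 : (∑ y, if m y q.2 = q.1 then p y * (if l y q.2 = a then 1 else 0) else 0)
        ≤ ∑ y, if m y q.2 = q.1 then p y else 0 :=
      Finset.sum_le_sum fun y _ => by split_ifs <;> simp [hp]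
    rw [Real.norm_of_nonneg (div_nonneg h1 (h1.trans h2))]
    exact div_le_one_of_le₀ h2 (h1.trans h2)
  have hle : MeasurableSpace.comap (fun ω => (m (V ω) (W ω), W ω)) inferInstance ≤ mΩ :=
    hMm.comap_le
  simp_rw [hRe]
  have hset : MeasurableSet ((fun ω => l (V ω) (W ω)) ⁻¹' {a}) := hLm (measurableSet_singleton a)
  refine (ae_eq_condExp_of_forall_setIntegral_eq hle ?_ ?_ ?_ ?_).symm
  · exact (integrable_const (1 : ℝ)).indicator hset
  · intro s _ _
    exact (Integrable.of_bound (hRm.comp hMm).aestronglyMeasurable 1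
      (Filter.Eventually.of_forall fun ω => hRb _)).integrableOn
  · rintro s ⟨C, hC, rfl⟩ _
    have hCx : ∀ x, MeasurableSet {w : 𝒲 | (m x w, w) ∈ C} := fun x =>
      ((hm x).prodMk measurable_id) hC
    rw [← integral_indicator (hMm hC), ← integral_indicator (hMm hC)]
    have e1 : ∀ ω, ((fun ω => (m (V ω) (W ω), W ω)) ⁻¹' C).indicator
        (fun ω => R (m (V ω) (W ω), W ω)) ω =
        (fun x w => (if (m x w, w) ∈ C then (1 : ℝ) else 0) * R (m x w, w)) (V ω) (W ω) := by
      intro ω; simp [Set.indicator]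
    have e2 : ∀ ω, ((fun ω => (m (V ω) (W ω), W ω)) ⁻¹' C).indicator
        (Set.indicator ((fun ω => l (V ω) (W ω)) ⁻¹' {a}) (fun _ => (1 : ℝ))) ω =
        (fun x w => (if (m x w, w) ∈ C then (1 : ℝ) else 0) *
          (if l x w = a then (1 : ℝ) else 0)) (V ω) (W ω) := by
      intro ω
      by_cases h1 : (m (V ω) (W ω), W ω) ∈ C <;> by_cases h2 : l (V ω) (W ω) = a <;>
        simp [Set.indicator, h1, h2]
    simp_rw [e1, e2]
    have m1 : ∀ x, Measurable (fun w => (if (m x w, w) ∈ C then (1 : ℝ) else 0) * R (m x w, w)) :=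
      fun x => (Measurable.ite (hCx x) measurable_const measurable_const).mul
        (hRm.comp ((hm x).prodMk measurable_id))
    have m2 : ∀ x, Measurable (fun w => (if (m x w, w) ∈ C then (1 : ℝ) else 0) *
          (if l x w = a then (1 : ℝ) else 0)) :=
      fun x => (Measurable.ite (hCx x) measurable_const measurable_const).mul
        (Measurable.ite ((hl x) (measurableSet_singleton a)) measurable_const measurable_const)
    rw [S9.integral_indep μ V W hV hW hI _ m1, S9.integral_indep μ V W hV hW hI _ m2]
    · congr 1
      ext ω
      exact S9.sum_cavg hp (fun x => m x (W ω)) (fun y => if l y (W ω) = a then 1 else 0)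
        (fun b => if (b, W ω) ∈ C then 1 else 0)
    · intro x
      refine Integrable.of_bound ((m2 x).comp hW).aestronglyMeasurable 1
        (Filter.Eventually.of_forall fun ω => ?_)
      split_ifs <;> simp
    · intro x
      refine Integrable.of_bound ((m1 x).comp hW).aestronglyMeasurable 1
        (Filter.Eventually.of_forall fun ω => ?_)
      have := hRb (m x (W ω), W ω)
      split_ifs <;> simp
      exact this
  · exact (Measurable.stronglyMeasurable (hRm.comp
      (comap_measurable (fun ω => (m (V ω) (W ω), W ω))))).aestronglyMeasurable

theorem S9.shCondEntropy_eq {Ω X 𝒲 α β γ : Type*} [mΩ : MeasurableSpace Ω] (μ : Measure Ω)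
    [IsProbabilityMeasure μ] [Fintype X] [MeasurableSpace X] [MeasurableSingletonClass X]
    [MeasurableSpace 𝒲] (V : Ω → X) (W : Ω → 𝒲) (hV : Measurable V) (hW : Measurable W)
    (hI : IndepFun V W μ)
    [MeasurableSpace α] [Countable α] [MeasurableSingletonClass α]
    [MeasurableSpace β] [Countable β] [MeasurableSingletonClass β] [MeasurableSpace γ]
    (l : X → 𝒲 → α) (hl : ∀ x, Measurable (l x)) (m : X → 𝒲 → β) (hm : ∀ x, Measurable (m x))
    (Z : Ω → γ) (hZ : MeasurableSpace.comap Z inferInstance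
      = MeasurableSpace.comap (fun ω => (m (V ω) (W ω), W ω)) inferInstance) :
    shCondEntropy μ (fun ω => l (V ω) (W ω)) Z
      = ∫ ω, S9.Ent (fun x => μ.real (V ⁻¹' {x})) (fun x => (l x (W ω), m x (W ω))) ∂μ
        - ∫ ω, S9.Ent (fun x => μ.real (V ⁻¹' {x})) (fun x => m x (W ω)) ∂μ := by
  classical
  set p : X → ℝ := fun x => μ.real (V ⁻¹' {x}) with hpdef
  have hp : ∀ x, 0 ≤ p x := fun x => measureReal_nonneg
  unfold shCondEntropy
  rw [hZ]
  have hall : ∀ᵐ ω ∂μ, ∀ a : α, _ :=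
    ae_all_iff.2 fun a => S9.condExp_eq μ V W hV hW hI l hl m hm a
  set ψ : X → 𝒲 → ℝ := fun x w => S9.cavg p (fun x => m x w)
    (fun y => -Real.log (S9.mass p (fun z => (l z w, m z w)) y / S9.mass p (fun z => m z w) y)) x
    with hψ
  have h1 : ∫ ω, ∑' a : α, Real.negMulLog
      ((μ[Set.indicator ((fun ω => l (V ω) (W ω)) ⁻¹' {a}) (fun _ => (1 : ℝ)) |
        MeasurableSpace.comap (fun ω => (m (V ω) (W ω), W ω)) inferInstance]) ω) ∂μ
      = ∫ ω, ψ (V ω) (W ω) ∂μ := by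
    refine integral_congr_ae ?_
    filter_upwards [hall] with ω hω
    rw [hψ]
    dsimp only
    rw [← S9.tsum_negMulLog p (fun x => l x (W ω)) (fun x => m x (W ω)) (V ω)]
    refine tsum_congr fun a => ?_
    rw [hω a]
  rw [h1]
  have hfac : ∀ x, Function.FactorsThrough (ψ x)
      (fun w => ((fun (x y : X) => (l y w = l x w)), (fun (x y : X) => (m y w = m x w)))) := by
    intro x w w' h
    have ha := congrArg Prod.fst h
    have hb := congrArg Prod.snd h
    have ha' : ∀ x y, l y w = l x w ↔ l y w' = l x w' := fun x y =>
      iff_of_eq (congrFun (congrFun ha x) y)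
    have hb' : ∀ x y, m y w = m x w ↔ m y w' = m x w' := fun x y =>
      iff_of_eq (congrFun (congrFun hb x) y)
    rw [hψ]
    unfold S9.cavg
    dsimp only
    rw [S9.mass_kernel p (fun z => m z w) (fun z => m z w') hb',
      S9.mass_kernel p (fun z => (l z w, m z w)) (fun z => (l z w', m z w'))
        (fun x y => by simp only [Prod.mk.injEq, ha' x y, hb' x y])]
    simp only [hb' x]
  have hpm := (S9.measurable_pattern l hl).prodMk (S9.measurable_pattern m hm)
  have hfacW : ∀ x, Function.FactorsThrough (fun ω => ψ x (W ω))
      (fun ω => ((fun (x y : X) => (l y (W ω) = l x (W ω))),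
        (fun (x y : X) => (m y (W ω) = m x (W ω))))) := fun x ω ω' h => hfac x h
  have hψi : ∀ x, Integrable (fun ω => ψ x (W ω)) μ := fun x =>
    (S9.integrable_of_factor μ _ (hpm.comp hW) _ (hfacW x)).2
  have hψm : ∀ x, Measurable (ψ x) := fun x =>
    (S9.integrable_of_factor (0 : Measure 𝒲) _ hpm _ (hfac x)).1
  rw [S9.integral_indep μ V W hV hW hI ψ hψm hψi, ← integral_sub
    (S9.integrable_Ent μ p W hW (fun x w => (l x w, m x w)) (fun x => (hl x).prodMk (hm x)))
    (S9.integrable_Ent μ p W hW m hm)]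
  congr 1
  ext ω
  have := S9.sum_cavg hp (fun x => m x (W ω))
    (fun y => -Real.log (S9.mass p (fun z => (l z (W ω), m z (W ω))) y /
      S9.mass p (fun z => m z (W ω)) y)) (fun _ => 1)
  simp only [one_mul] at this
  rw [hψ]
  refine this.trans ?_
  unfold S9.Ent
  rw [← Finset.sum_sub_distrib]
  refine Finset.sum_congr rfl fun x _ => ?_
  by_cases hx : p x = 0
  · simp [hx]
  rw [Real.log_div (S9.mass_pos hp _ hx).ne' (S9.mass_pos hp _ hx).ne']; ring

theorem S9.shEntropy_eq {Ω X α : Type*} [mΩ : MeasurableSpace Ω] (μ : Measure Ω)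
    [IsProbabilityMeasure μ] [Fintype X] [MeasurableSpace X] [MeasurableSingletonClass X]
    (V : Ω → X) (hV : Measurable V) (f : X → α) :
    shEntropy μ (fun ω => f (V ω)) = S9.Ent (fun x => μ.real (V ⁻¹' {x})) f := by
  classical
  set p : X → ℝ := fun x => μ.real (V ⁻¹' {x}) with hpdef
  have key : ∀ a, (μ ((fun ω => f (V ω)) ⁻¹' {a})).toReal
      = ∑ y, if f y = a then p y else 0 := by
    intro a
    have : (fun ω => f (V ω)) ⁻¹' {a} =
        ⋃ y ∈ Finset.univ.filter (fun y => f y = a), V ⁻¹' {y} := by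
      ext ω; simp
    rw [this, ← Finset.sum_filter]
    change μ.real _ = _
    rw [measureReal_biUnion_finset]
    · intro x _ y _ hxy
      exact Disjoint.preimage _ (by simpa using hxy)
    · intro y _; exact hV (measurableSet_singleton y)
  unfold shEntropy
  simp_rw [key]
  rw [tsum_eq_sum (s := Finset.univ.image f)]
  · unfold S9.Ent
    have : ∀ x, p x * -Real.log (S9.mass p f x)
        = ∑ a ∈ Finset.univ.image f, if f x = a then p x * -Real.log (S9.mass p f x) else 0 := by
      intro x
      rw [Finset.sum_ite_eq, if_pos (Finset.mem_image_of_mem f (Finset.mem_univ x))]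
    rw [Finset.sum_congr rfl (fun x _ => this x), Finset.sum_comm]
    refine Finset.sum_congr rfl fun a _ => ?_
    rw [Real.negMulLog, neg_mul_comm, Finset.sum_mul]
    refine Finset.sum_congr rfl fun y _ => ?_
    by_cases h : f y = a
    · subst h
      rw [if_pos rfl, if_pos rfl]; unfold S9.mass; rfl
    · simp [h]
  · intro a ha
    rw [Finset.sum_eq_zero]
    · simp
    · intro y _
      rw [if_neg]
      rintro rfl
      exact ha (Finset.mem_image_of_mem f (Finset.mem_univ y))
/-- averaged aligned-image-sets bound -/
theorem S9.Ent_le_integral {Ω X 𝒲 α κ : Type*} [mΩ : MeasurableSpace Ω] (μ : Measure Ω)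
    [IsProbabilityMeasure μ] [Fintype X] [MeasurableSpace 𝒲] (W : Ω → 𝒲) (hW : Measurable W)
    [MeasurableSpace α] [Countable α] [MeasurableSingletonClass α]
    (l : X → 𝒲 → α) (hl : ∀ x, Measurable (l x))
    (p : X → ℝ) (hp : ∀ x, 0 ≤ p x) (h1 : ∑ x, p x = 1) (f : X → κ) (K : ℝ) (hK : 0 < K)
    (h : ∀ y, ∑ x, p x / S9.mass p f x * μ.real {ω | l y (W ω) = l x (W ω)} ≤ K) :
    S9.Ent p f ≤ ∫ ω, S9.Ent p (fun x => l x (W ω)) ∂μ + Real.log K := by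
  classical
  have hms : ∀ x y, MeasurableSet {ω | l y (W ω) = l x (W ω)} := fun x y =>
    measurableSet_eq_fun ((hl y).comp hW) ((hl x).comp hW)
  have hpt : ∀ ω, S9.Ent p f - S9.Ent p (fun x => l x (W ω)) ≤ Real.log K - 1 +
      (∑ x, p x * (S9.mass p (fun x => l x (W ω)) x / S9.mass p f x)) / K := by
    intro ω
    refine le_trans (le_of_eq ?_) (S9.gibbs hp h1
      (fun x => S9.mass p (fun x => l x (W ω)) x / S9.mass p f x)
      (fun x hx => div_pos (S9.mass_pos hp _ hx) (S9.mass_pos hp _ hx)) K hK)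
    unfold S9.Ent
    rw [← Finset.sum_sub_distrib]
    refine Finset.sum_congr rfl fun x _ => ?_
    by_cases hx : p x = 0
    · simp [hx]
    rw [Real.log_div (S9.mass_pos hp _ hx).ne' (S9.mass_pos hp _ hx).ne']; ring
  have hre : ∀ ω, ∑ x, p x * (S9.mass p (fun x => l x (W ω)) x / S9.mass p f x)
      = ∑ y, ∑ x, (p y * (p x / S9.mass p f x)) *
        ({ω | l y (W ω) = l x (W ω)}.indicator 1 ω : ℝ) := by
    intro ω
    rw [Finset.sum_comm]
    refine Finset.sum_congr rfl fun x _ => ?_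
    conv_lhs => enter [2, 1]; unfold S9.mass
    rw [Finset.sum_div, Finset.mul_sum]
    refine Finset.sum_congr rfl fun y _ => ?_
    by_cases hh : l y (W ω) = l x (W ω)
    · simp [Set.indicator, hh]; ring
    · simp [Set.indicator, hh]
  have hi1 : ∀ y x, Integrable (fun ω => (p y * (p x / S9.mass p f x)) *
        ({ω | l y (W ω) = l x (W ω)}.indicator 1 ω : ℝ)) μ := fun y x =>
    ((integrable_const (1 : ℝ)).indicator (hms x y)).const_mul _
  have hi2 : ∀ y, Integrable (fun ω => ∑ x, (p y * (p x / S9.mass p f x)) *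
        ({ω | l y (W ω) = l x (W ω)}.indicator 1 ω : ℝ)) μ := fun y =>
    integrable_finsetSum _ fun x _ => hi1 y x
  have hi3 : Integrable (fun ω => ∑ y, ∑ x, (p y * (p x / S9.mass p f x)) *
        ({ω | l y (W ω) = l x (W ω)}.indicator 1 ω : ℝ)) μ :=
    integrable_finsetSum _ fun y _ => hi2 y
  have hintegral : ∫ ω, ∑ x, p x * (S9.mass p (fun x => l x (W ω)) x / S9.mass p f x) ∂μ ≤ K := by
    simp_rw [hre]
    rw [integral_finsetSum _ (fun y _ => hi2 y)]
    calc ∑ y, ∫ ω, ∑ x, (p y * (p x / S9.mass p f x)) *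
          ({ω | l y (W ω) = l x (W ω)}.indicator 1 ω : ℝ) ∂μ
        = ∑ y, p y * ∑ x, p x / S9.mass p f x * μ.real {ω | l y (W ω) = l x (W ω)} := by
          refine Finset.sum_congr rfl fun y _ => ?_
          rw [integral_finsetSum _ (fun x _ => hi1 y x), Finset.mul_sum]
          refine Finset.sum_congr rfl fun x _ => ?_
          rw [integral_const_mul, integral_indicator_one (hms x y)]; ring
      _ ≤ ∑ y, p y * K := Finset.sum_le_sum fun y _ => mul_le_mul_of_nonneg_left (h y) (hp y)
      _ = K := by rw [← Finset.sum_mul, h1, one_mul]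
  have hEi := S9.integrable_Ent μ p W hW l hl
  have hi4 : Integrable (fun ω => Real.log K - 1 +
      (∑ x, p x * (S9.mass p (fun x => l x (W ω)) x / S9.mass p f x)) / K) μ := by
    simp_rw [hre]
    exact (integrable_const _).add (hi3.div_const K)
  have := integral_mono ((integrable_const (S9.Ent p f)).sub hEi) hi4 hpt
  rw [integral_add (integrable_const _) (by simp_rw [hre]; exact hi3.div_const K),
    integral_div] at this
  simp only [Pi.sub_apply] at this
  rw [integral_sub (integrable_const _) hEi] at this
  simp only [integral_const, probReal_univ, one_smul] at this
  have h5 := (div_le_one hK).2 hintegral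
  linarith

theorem S9.Ent_le_prod {Ω X 𝒲 α κ : Type*} [mΩ : MeasurableSpace Ω] (μ : Measure Ω)
    [IsProbabilityMeasure μ] [Fintype X] [MeasurableSpace 𝒲] (W : Ω → 𝒲) (hW : Measurable W)
    [MeasurableSpace α] [Countable α] [MeasurableSingletonClass α]
    (l : X → 𝒲 → α) (hl : ∀ x, Measurable (l x))
    (p : X → ℝ) (hp : ∀ x, 0 ≤ p x) (h1 : ∑ x, p x = 1) (n : ℕ) (f : X → Fin n → κ)
    (Box : Finset κ) (hBox : ∀ x t, f x t ∈ Box) (b : κ → κ → ℝ) (hb0 : ∀ v v', 0 ≤ b v v')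
    (hb : ∀ x y, μ.real {ω | l y (W ω) = l x (W ω)} ≤ ∏ t, b (f x t) (f y t))
    (K : ℝ) (hK : 0 < K) (hs : ∀ v' ∈ Box, ∑ v ∈ Box, b v v' ≤ K) :
    S9.Ent p f ≤ ∫ ω, S9.Ent p (fun x => l x (W ω)) ∂μ + n * Real.log K := by
  classical
  rw [← Real.log_pow]
  refine S9.Ent_le_integral μ W hW l hl p hp h1 f (K ^ n) (pow_pos hK n) fun y => ?_
  calc ∑ x, p x / S9.mass p f x * μ.real {ω | l y (W ω) = l x (W ω)}
      ≤ ∑ x, p x / S9.mass p f x * ∏ t, b (f x t) (f y t) :=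
        Finset.sum_le_sum fun x _ => mul_le_mul_of_nonneg_left (hb x y)
          (div_nonneg (hp x) (S9.mass_nonneg hp f x))
    _ ≤ ∑ v ∈ Finset.univ.image f, ∏ t, b (v t) (f y t) :=
        S9.sum_div_mass hp f Finset.univ (fun v => ∏ t, b (v t) (f y t))
          (fun v => Finset.prod_nonneg fun t _ => hb0 _ _)
    _ ≤ ∑ v ∈ Fintype.piFinset (fun _ : Fin n => Box), ∏ t, b (v t) (f y t) := by
        refine Finset.sum_le_sum_of_subset_of_nonneg ?_
          fun v _ _ => Finset.prod_nonneg fun t _ => hb0 _ _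
        intro v hv
        obtain ⟨x, -, rfl⟩ := Finset.mem_image.1 hv
        exact Fintype.mem_piFinset.2 (hBox x)
    _ = ∏ t : Fin n, ∑ v ∈ Box, b v (f y t) :=
        (Finset.prod_univ_sum (fun _ : Fin n => Box) (fun t v => b v (f y t))).symm
    _ ≤ ∏ _t : Fin n, K := Finset.prod_le_prod
        (fun t _ => Finset.sum_nonneg fun v _ => hb0 _ _) (fun t _ => hs _ (hBox y t))
    _ = K ^ n := by simp
/-! ## Probability of aligned images -/

theorem S9.abs_truncZ_sub (x : ℝ) : |(truncZ x : ℝ) - x| ≤ 1 := by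
  unfold truncZ
  split_ifs with h
  · rw [abs_le]
    constructor <;> linarith [Int.floor_le x, Int.lt_floor_add_one x]
  · rw [abs_le]
    constructor <;> linarith [Int.le_ceil x, Int.ceil_lt_add_one x]

theorem S9.abs_truncZ_le (x : ℝ) : |(truncZ x : ℝ)| ≤ |x| := by
  unfold truncZ
  split_ifs with h
  · have h1 : (0 : ℝ) ≤ (⌊x⌋ : ℝ) := by exact_mod_cast Int.floor_nonneg.2 h
    rw [abs_of_nonneg h, abs_of_nonneg h1]; exact Int.floor_le x
  · push Not at h
    have h1 : (⌈x⌉ : ℝ) ≤ 0 := by exact_mod_cast Int.ceil_le.2 (by simpa using h.le)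
    rw [abs_of_neg h, abs_of_nonpos h1]; linarith [Int.le_ceil x]

theorem S9.measurable_truncZ : Measurable truncZ := by
  unfold truncZ
  exact Measurable.ite measurableSet_Ici Int.measurable_floor Int.measurable_ceil

theorem S9.law_le {Ω ι J : Type} [MeasurableSpace Ω] [DecidableEq ι] [Fintype J] [Nonempty J]
    (μ : Measure Ω) [IsProbabilityMeasure μ] (G : ι → Ω → ℝ) (hG : ∀ i, Measurable (G i))
    (Δ₁ Δ₂ fmax : ℝ)
    (hB : BoundedDensityFamily μ G Δ₁ Δ₂ fmax) (e : J → ι) (he : Function.Injective e)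
    (S : Set (J → ℝ)) (hS : MeasurableSet S) :
    μ ((fun ω j => G (e j) ω) ⁻¹' S)
      ≤ ENNReal.ofReal (fmax ^ Fintype.card J) * volume S := by
  classical
  set s : Finset ι := Finset.univ.image e with hs
  have hmem : ∀ j, e j ∈ s := fun j => Finset.mem_image_of_mem e (Finset.mem_univ j)
  let ε : J ≃ s := Equiv.ofBijective (fun j => ⟨e j, hmem j⟩)
    ⟨fun a b h => he (by simpa using h), fun ⟨i, hi⟩ => by
      obtain ⟨j, -, rfl⟩ := Finset.mem_image.1 hi
      exact ⟨j, rfl⟩⟩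
  have hmp := volume_measurePreserving_piCongrLeft (fun _ : s => ℝ) ε
  set T := MeasurableEquiv.piCongrLeft (fun _ : s => ℝ) ε with hT
  have hTa : ∀ (h : J → ℝ) j, T h (ε j) = h j := fun h j =>
    Equiv.piCongrLeft_apply_apply (P := fun _ : s => ℝ) ε h j
  set S' : Set (s → ℝ) := T.symm ⁻¹' S with hS'
  have hS'm : MeasurableSet S' := T.symm.measurable hS
  have hvol : volume S' = volume S := hmp.symm.measure_preimage_equiv S
  have hpre : (fun ω (i : s) => G i ω) ⁻¹' S' = (fun ω j => G (e j) ω) ⁻¹' S := by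
    ext ω
    have : T.symm (fun i : s => G i ω) = fun j => G (e j) ω := by
      rw [MeasurableEquiv.symm_apply_eq]
      ext i
      obtain ⟨j, rfl⟩ := ε.surjective i
      rw [hTa]; rfl
    simp only [Set.mem_preimage, hS', this]
  have h := hB.2 s ∅ ⟨e (Classical.arbitrary J), hmem _⟩ (Finset.disjoint_empty_right s) S' hS'm
  rw [hpre, hvol] at h
  have hset : MeasurableSet ((fun ω j => G (e j) ω) ⁻¹' S) :=
    (measurable_pi_lambda _ fun j => hG (e j)) hS
  have hbot : MeasurableSpace.comap (fun ω (j : (∅ : Finset ι)) => G j ω) inferInstance = ⊥ := by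
    have : (fun ω (j : (∅ : Finset ι)) => G j ω) = fun _ => (fun j => 0) := by
      ext ω j; exact absurd j.2 (Finset.notMem_empty _)
    rw [this, MeasurableSpace.comap_const]
  rw [hbot, condExp_bot] at h
  obtain ⟨ω, hω⟩ := h.exists
  have e1 : ∫ ω, Set.indicator ((fun ω j => G (e j) ω) ⁻¹' S) (fun _ => (1 : ℝ)) ω ∂μ
      = μ.real ((fun ω j => G (e j) ω) ⁻¹' S) := integral_indicator_one hset
  rw [e1, ofReal_measureReal, Finset.card_image_of_injective _ he, Finset.card_univ] at hω
  exact hω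

theorem S9.volume_blocks {A B : Type} [Fintype A] [Fintype B] (E : A → Set (B → ℝ))
    (hE : ∀ a, MeasurableSet (E a)) :
    volume {h : A × B → ℝ | ∀ a, (fun i => h (a, i)) ∈ E a} = ∏ a, volume (E a) := by
  classical
  set T : (A → B → ℝ) → (A × B → ℝ) := fun h j => h j.1 j.2 with hT
  have hTm : Measurable T := measurable_pi_lambda _ fun j =>
    (measurable_pi_apply j.2).comp (measurable_pi_apply j.1)
  have hmap : (volume : Measure (A × B → ℝ)) = Measure.map T volume := by
    refine Measure.pi_eq fun s hs => ?_
    rw [Measure.map_apply hTm (MeasurableSet.univ_pi hs)]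
    have : T ⁻¹' Set.univ.pi s = Set.univ.pi (fun a => Set.univ.pi (fun b => s (a, b))) := by
      ext h; simp [hT, Set.mem_pi]
    rw [this, volume_pi_pi]
    simp_rw [volume_pi_pi]
    rw [Fintype.prod_prod_type]
  rw [hmap, Measure.map_apply hTm]
  · have : T ⁻¹' {h : A × B → ℝ | ∀ a, (fun i => h (a, i)) ∈ E a} = Set.univ.pi E := by
      ext h; simp [hT, Set.mem_pi]
    rw [this, volume_pi_pi]
  · rw [Set.ofPred_forall]
    refine MeasurableSet.iInter fun a => ?_
    exact (measurable_pi_lambda _ fun i => measurable_pi_apply (a, i)) (hE a)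

theorem S9.volume_slice (N : ℕ) (Δ : ℝ) (E : Set (Fin (N + 1) → ℝ)) (hE : MeasurableSet E)
    (hbox : ∀ g ∈ E, ∀ i, |g i| ≤ Δ) (i0 : Fin (N + 1)) (B : ENNReal)
    (hB : ∀ g : Fin N → ℝ, volume {a : ℝ | i0.insertNth a g ∈ E} ≤ B) :
    volume E ≤ B * ENNReal.ofReal (2 * Δ) ^ N := by
  have hmp := volume_preserving_piFinSuccAbove (fun _ : Fin (N + 1) => ℝ) i0
  rw [← hmp.symm.measure_preimage_equiv E]
  have hm : MeasurableSet ((MeasurableEquiv.piFinSuccAbove (fun _ : Fin (N + 1) => ℝ) i0).symm ⁻¹' E) :=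
    (MeasurableEquiv.measurable _) hE
  rw [Measure.volume_eq_prod, Measure.prod_apply_symm hm]
  have hle : ∀ g : Fin N → ℝ,
      volume ((fun a => (a, g)) ⁻¹'
        ((MeasurableEquiv.piFinSuccAbove (fun _ : Fin (N + 1) => ℝ) i0).symm ⁻¹' E))
      ≤ (Set.univ.pi (fun _ : Fin N => Set.Icc (-Δ) Δ)).indicator (fun _ => B) g := by
    intro g
    have e : (fun a => (a, g)) ⁻¹'
        ((MeasurableEquiv.piFinSuccAbove (fun _ : Fin (N + 1) => ℝ) i0).symm ⁻¹' E)
        = {a : ℝ | i0.insertNth a g ∈ E} := rfl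
    rw [e]
    by_cases hg : g ∈ Set.univ.pi (fun _ : Fin N => Set.Icc (-Δ) Δ)
    · rw [Set.indicator_of_mem hg]; exact hB g
    · rw [Set.indicator_of_notMem hg]
      have : {a : ℝ | i0.insertNth a g ∈ E} = ∅ := by
        ext a
        simp only [Set.mem_ofPred_eq, Set.mem_empty_iff_false, iff_false]
        intro ha
        apply hg
        intro i _
        have := hbox _ ha (i0.succAbove i)
        rw [Fin.insertNth_apply_succAbove] at this
        exact abs_le.1 this
      rw [this]; simp
  refine (lintegral_mono hle).trans ?_
  rw [lintegral_indicator_const (MeasurableSet.univ_pi fun _ => measurableSet_Icc), volume_pi_pi]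
  simp only [Real.volume_Icc, Finset.prod_const, Finset.card_univ, Fintype.card_fin]
  rw [show Δ - -Δ = 2 * Δ by ring]

/-- set of coefficient vectors for which the images are aligned -/
def S9.Ev (N : ℕ) (Δ : ℝ) (D : Finset ℤ) (x y : Fin N → ℤ) : Set (Fin N → ℝ) :=
  {g | (∀ i, |g i| ≤ Δ) ∧ ∑ i, (truncZ (g i * x i) - truncZ (g i * y i)) ∈ D}

theorem S9.measurable_diff {N : ℕ} (x y : Fin N → ℤ) :
    Measurable fun g : Fin N → ℝ => ∑ i, (truncZ (g i * x i) - truncZ (g i * y i)) := by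
  refine Finset.measurable_sum _ fun i _ => Measurable.sub ?_ ?_
  · exact S9.measurable_truncZ.comp ((measurable_pi_apply i).mul_const _)
  · exact S9.measurable_truncZ.comp ((measurable_pi_apply i).mul_const _)

theorem S9.measurableSet_Ev (N : ℕ) (Δ : ℝ) (D : Finset ℤ) (x y : Fin N → ℤ) :
    MeasurableSet (S9.Ev N Δ D x y) := by
  refine MeasurableSet.inter ?_ ?_
  · change MeasurableSet {g : Fin N → ℝ | ∀ i, |g i| ≤ Δ}
    rw [Set.ofPred_forall]
    exact MeasurableSet.iInter fun i =>
      measurableSet_le (measurable_pi_apply i).abs measurable_const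
  · exact S9.measurable_diff x y (MeasurableSet.of_discrete (s := (D : Set ℤ)))

theorem S9.volume_Ev (N : ℕ) (Δ : ℝ) (hΔ : 0 ≤ Δ) (D : Finset ℤ) (x y : Fin (N + 1) → ℤ)
    (i0 : Fin (N + 1)) :
    volume (S9.Ev (N + 1) Δ D x y) ≤
      ENNReal.ofReal ((8 * D.card + 2 * Δ) * (1 / (1 + |(x i0 : ℝ) - y i0|)) * (2 * Δ) ^ N) := by
  have h2 : (0 : ℝ) ≤ 2 * Δ := by linarith
  have h0 : 0 ≤ (8 * D.card + 2 * Δ) * (1 / (1 + |(x i0 : ℝ) - y i0|)) := by positivity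
  rw [ENNReal.ofReal_mul h0, ENNReal.ofReal_pow h2]
  refine S9.volume_slice N Δ _ (S9.measurableSet_Ev _ _ _ _ _) (fun g hg => hg.1) i0 _ ?_
  intro g
  by_cases hxy : x i0 = y i0
  · rw [hxy]
    simp only [sub_self, abs_zero, add_zero, div_one, mul_one]
    calc volume {a : ℝ | i0.insertNth a g ∈ S9.Ev (N + 1) Δ D x y}
        ≤ volume (Set.Icc (-Δ) Δ) := by
          refine measure_mono fun a ha => ?_
          have := ha.1 i0
          rw [Fin.insertNth_apply_same] at this
          exact abs_le.1 this
      _ ≤ _ := by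
          rw [Real.volume_Icc]
          refine ENNReal.ofReal_le_ofReal ?_
          have : (0 : ℝ) ≤ D.card := by positivity
          linarith
  · set δ : ℝ := (x i0 : ℝ) - y i0 with hδ
    have hδ1 : 1 ≤ |δ| := by
      rw [hδ]
      exact_mod_cast Int.one_le_abs (sub_ne_zero.2 hxy)
    have hδ0 : δ ≠ 0 := by
      intro h; rw [h] at hδ1; simp at hδ1; linarith
    set r : ℤ := ∑ i, (truncZ (g i * x (i0.succAbove i)) - truncZ (g i * y (i0.succAbove i)))
      with hr
    calc volume {a : ℝ | i0.insertNth a g ∈ S9.Ev (N + 1) Δ D x y}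
        ≤ volume (⋃ d ∈ D, Metric.closedBall (((d : ℝ) - r) / δ) (2 / |δ|)) := by
          refine measure_mono fun a ha => ?_
          have h3 := ha.2
          rw [Fin.sum_univ_succAbove _ i0] at h3
          simp only [Fin.insertNth_apply_same, Fin.insertNth_apply_succAbove] at h3
          rw [← hr] at h3
          refine Set.mem_iUnion₂.2 ⟨_, h3, ?_⟩
          rw [Metric.mem_closedBall, Real.dist_eq]
          push_cast
          have b1 := S9.abs_truncZ_sub (a * x i0)
          have b2 := S9.abs_truncZ_sub (a * y i0)
          have : a - ((truncZ (a * x i0) : ℝ) - truncZ (a * y i0) + r - r) / δ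
              = (a * δ - ((truncZ (a * x i0) : ℝ) - truncZ (a * y i0))) / δ := by
            field_simp; ring_nf
          rw [this, abs_div]
          refine div_le_div_of_nonneg_right ?_ (abs_nonneg δ)
          rw [hδ]
          rw [abs_le] at b1 b2 ⊢
          constructor <;> nlinarith [b1.1, b1.2, b2.1, b2.2]
      _ ≤ ∑ d ∈ D, volume (Metric.closedBall (((d : ℝ) - r) / δ) (2 / |δ|)) :=
          measure_biUnion_finset_le _ _
      _ = D.card * ENNReal.ofReal (2 * (2 / |δ|)) := by
          simp only [Real.volume_closedBall, Finset.sum_const, nsmul_eq_mul]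
      _ = ENNReal.ofReal (D.card * (2 * (2 / |δ|))) := by
          rw [ENNReal.ofReal_mul (Nat.cast_nonneg _), ENNReal.ofReal_natCast]
      _ ≤ _ := by
          refine ENNReal.ofReal_le_ofReal ?_
          have hc : (0 : ℝ) ≤ D.card := by positivity
          have h5 : 1 / |δ| ≤ 2 * (1 / (1 + |δ|)) := by
            rw [mul_one_div, div_le_div_iff₀ (by linarith) (by linarith)]; linarith
          have h6 : 0 ≤ 1 / (1 + |δ|) := by positivity
          calc (D.card : ℝ) * (2 * (2 / |δ|)) = 4 * D.card * (1 / |δ|) := by ring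
            _ ≤ 4 * D.card * (2 * (1 / (1 + |δ|))) :=
              mul_le_mul_of_nonneg_left h5 (by linarith)
            _ ≤ _ := by nlinarith

theorem S9.prob_le {Ω ι : Type} [MeasurableSpace Ω] [DecidableEq ι]
    (μ : Measure Ω) [IsProbabilityMeasure μ] (G : ι → Ω → ℝ) (hG : ∀ i, Measurable (G i))
    (Δ₁ Δ₂ fmax : ℝ) (hΔ : 0 ≤ Δ₂) (hf : 0 ≤ fmax)
    (hB : BoundedDensityFamily μ G Δ₁ Δ₂ fmax) (n : ℕ) (hn : 1 ≤ n)
    (idx : Fin 2 → Fin n → Fin 7 → ι)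
    (hidx : Function.Injective (fun p : Fin 2 × Fin n × Fin 7 => idx p.1 p.2.1 p.2.2))
    (D : Finset ℤ) (x y : Fin n → Fin 7 → ℤ) (r : Fin n → ℝ)
    (hr : ∀ t, ∃ i, 1 / (1 + |(x t i : ℝ) - y t i|) ≤ r t) :
    μ.real {ω | (∀ k t i, |G (idx k t i) ω| ≤ Δ₂) ∧ ∀ k t,
      ∑ i, (truncZ (G (idx k t i) ω * x t i) - truncZ (G (idx k t i) ω * y t i)) ∈ D}
      ≤ ∏ t, (fmax ^ 7 * ((8 * D.card + 2 * Δ₂) * (2 * Δ₂) ^ 6) * r t) ^ 2 := by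
  have : NeZero n := ⟨by omega⟩
  set C := (8 * (D.card : ℝ) + 2 * Δ₂) * (2 * Δ₂) ^ 6 with hC
  have hC0 : 0 ≤ C := by positivity
  have hr0 : ∀ t, 0 ≤ r t := fun t => by
    obtain ⟨i, hi⟩ := hr t
    exact le_trans (by positivity) hi
  set E : Fin 2 × Fin n → Set (Fin 7 → ℝ) := fun a => S9.Ev 7 Δ₂ D (x a.2) (y a.2) with hE
  set e : (Fin 2 × Fin n) × Fin 7 → ι := fun j => idx j.1.1 j.1.2 j.2 with he
  have hei : Function.Injective e := by
    rintro ⟨⟨a, b⟩, c⟩ ⟨⟨a', b'⟩, c'⟩ h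
    have := @hidx (a, b, c) (a', b', c') h
    simp only [Prod.mk.injEq] at this ⊢
    tauto
  set S : Set ((Fin 2 × Fin n) × Fin 7 → ℝ) := {h | ∀ a, (fun i => h (a, i)) ∈ E a} with hS
  have hSm : MeasurableSet S := by
    rw [hS, Set.ofPred_forall]
    refine MeasurableSet.iInter fun a => ?_
    exact (measurable_pi_lambda _ fun i => measurable_pi_apply (a, i))
      (S9.measurableSet_Ev _ _ _ _ _)
  have hset : {ω | (∀ k t i, |G (idx k t i) ω| ≤ Δ₂) ∧ ∀ k t,
      ∑ i, (truncZ (G (idx k t i) ω * x t i) - truncZ (G (idx k t i) ω * y t i)) ∈ D}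
      ⊆ (fun ω j => G (e j) ω) ⁻¹' S := by
    rintro ω ⟨h1, h2⟩ ⟨k, t⟩
    exact ⟨fun i => h1 k t i, h2 k t⟩
  have hlaw := S9.law_le μ G hG Δ₁ Δ₂ fmax hB e hei S hSm
  have hvolE : ∀ a, volume (E a) ≤ ENNReal.ofReal (C * r a.2) := by
    intro a
    obtain ⟨i, hi⟩ := hr a.2
    refine (S9.volume_Ev 6 Δ₂ hΔ D (x a.2) (y a.2) i).trans (ENNReal.ofReal_le_ofReal ?_)
    have : (8 * (D.card : ℝ) + 2 * Δ₂) * (1 / (1 + |(x a.2 i : ℝ) - y a.2 i|)) * (2 * Δ₂) ^ 6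
      = C * (1 / (1 + |(x a.2 i : ℝ) - y a.2 i|)) := by rw [hC]; ring
    rw [this]
    exact mul_le_mul_of_nonneg_left hi hC0
  have hfin : μ ((fun ω j => G (e j) ω) ⁻¹' S) ≤
      ENNReal.ofReal (∏ t, (fmax ^ 7 * C * r t) ^ 2) := by
    refine hlaw.trans ?_
    rw [hS, S9.volume_blocks E (fun a => S9.measurableSet_Ev _ _ _ _ _)]
    refine (mul_le_mul_right (Finset.prod_le_prod' fun a _ => hvolE a) _).trans ?_
    rw [← ENNReal.ofReal_prod_of_nonneg (fun a _ => mul_nonneg hC0 (hr0 _)),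
      ← ENNReal.ofReal_mul (by positivity)]
    refine ENNReal.ofReal_le_ofReal (le_of_eq ?_)
    simp only [Fintype.prod_prod_type, Fin.prod_univ_two, Fintype.card_prod, Fintype.card_fin]
    simp only [mul_pow, Finset.prod_mul_distrib, Finset.prod_const, Finset.card_univ,
      Fintype.card_fin, Finset.prod_pow]
    ring_nf
  refine ENNReal.toReal_le_of_le_ofReal (Finset.prod_nonneg fun t _ => sq_nonneg _) ?_
  exact (measure_mono hset).trans hfin

/-- The harmonic kernel. -/
noncomputable def S9.hk (a b : ℤ) : ℝ := 1 / (1 + |(a : ℝ) - b|)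

/-- The nearness kernel. -/
noncomputable def S9.nk (a b : ℤ) : ℝ := if |a - b| ≤ 1 then 1 else 0

theorem S9.hk_nonneg (a b : ℤ) : 0 ≤ S9.hk a b := by unfold S9.hk; positivity

theorem S9.nk_nonneg (a b : ℤ) : 0 ≤ S9.nk a b := by unfold S9.nk; split_ifs <;> norm_num

theorem S9.sum_hk_aux (R : ℕ) (a' : ℤ) (s : Finset ℤ)
    (hs : ∀ a ∈ s, |a - a'| ≤ R) (hinj : Set.InjOn (fun a : ℤ => (a - a').natAbs) s) :
    ∑ a ∈ s, S9.hk a a' ≤ 1 + Real.log (R + 1) := by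
  have h1 : ∑ a ∈ s, S9.hk a a' = ∑ a ∈ s, (fun k : ℕ => 1 / (1 + (k : ℝ))) (a - a').natAbs := by
    refine Finset.sum_congr rfl fun a _ => ?_
    simp only [S9.hk]
    rw [Nat.cast_natAbs]
    push_cast
    rfl
  rw [h1, ← Finset.sum_image (f := fun k : ℕ => 1 / (1 + (k : ℝ))) hinj]
  have h2 : ∑ k ∈ s.image (fun a : ℤ => (a - a').natAbs), 1 / (1 + (k : ℝ))
      ≤ ∑ k ∈ Finset.range (R + 1), 1 / (1 + (k : ℝ)) := by
    refine Finset.sum_le_sum_of_subset_of_nonneg ?_ fun k _ _ => by positivity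
    intro k hk
    obtain ⟨a, ha, rfl⟩ := Finset.mem_image.1 hk
    have := hs a ha
    rw [abs_le] at this
    simp only [Finset.mem_range]
    omega
  refine h2.trans ?_
  have h3 := harmonic_le_one_add_log (R + 1)
  simp only [harmonic] at h3
  push_cast at h3
  refine le_trans (le_of_eq ?_) h3
  refine Finset.sum_congr rfl fun k _ => ?_
  rw [one_div, add_comm]

theorem S9.sum_hk (R : ℕ) (a' : ℤ) (ha' : a' ∈ Finset.Icc (0 : ℤ) R) :
    ∑ a ∈ Finset.Icc (0 : ℤ) R, S9.hk a a' ≤ 2 * (1 + Real.log (R + 1)) := by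
  rw [← Finset.sum_filter_add_sum_filter_not _ (fun a => a ≤ a')]
  rw [Finset.mem_Icc] at ha'
  have h1 := S9.sum_hk_aux R a' ((Finset.Icc (0 : ℤ) R).filter (fun a => a ≤ a'))
    (by intro a ha; simp only [Finset.mem_filter, Finset.mem_Icc] at ha; rw [abs_le]; omega)
    (by intro a ha b hb; simp only [Finset.coe_filter, Finset.mem_Icc, Set.mem_ofPred_eq] at ha hb
        dsimp only; omega)
  have h2 := S9.sum_hk_aux R a' ((Finset.Icc (0 : ℤ) R).filter (fun a => ¬ a ≤ a'))
    (by intro a ha; simp only [Finset.mem_filter, Finset.mem_Icc] at ha; rw [abs_le]; omega)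
    (by intro a ha b hb; simp only [Finset.coe_filter, Finset.mem_Icc, Set.mem_ofPred_eq] at ha hb
        dsimp only; omega)
  linarith

theorem S9.sum_nk (R : ℕ) (a' : ℤ) :
    ∑ a ∈ Finset.Icc (0 : ℤ) R, S9.nk a a' ≤ 3 := by
  unfold S9.nk
  rw [Finset.sum_boole]
  have : ((Finset.Icc (0 : ℤ) R).filter (fun a => |a - a'| ≤ 1)).card
      ≤ (Finset.Icc (a' - 1) (a' + 1)).card := by
    refine Finset.card_le_card fun a ha => ?_
    simp only [Finset.mem_filter, Finset.mem_Icc, abs_le] at ha ⊢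
    omega
  rw [Int.card_Icc] at this
  have h3 : ((Finset.Icc (0 : ℤ) R).filter (fun a => |a - a'| ≤ 1)).card ≤ 3 := by omega
  exact_mod_cast h3

/-- Full per-time kernel. -/
noncomputable def S9.bk (Q : ℕ) (v v' : ℤ × ℤ × ℤ × ℤ) : ℝ :=
  (S9.nk v.1 v'.1 * (S9.nk v.2.1 v'.2.1 * (S9.hk v.2.2.1 v'.2.2.1 * S9.hk v.2.2.2 v'.2.2.2)))
    + 9 / (Q : ℝ) ^ 2 * (S9.hk v.1 v'.1 * (S9.hk v.2.1 v'.2.1 * (1 * 1)))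

theorem S9.bk_nonneg (Q : ℕ) (v v' : ℤ × ℤ × ℤ × ℤ) : 0 ≤ S9.bk Q v v' := by
  unfold S9.bk
  have := S9.nk_nonneg; have := S9.hk_nonneg
  refine add_nonneg ?_ ?_
  · exact mul_nonneg (S9.nk_nonneg _ _) (mul_nonneg (S9.nk_nonneg _ _)
      (mul_nonneg (S9.hk_nonneg _ _) (S9.hk_nonneg _ _)))
  · exact mul_nonneg (by positivity) (mul_nonneg (S9.hk_nonneg _ _)
      (mul_nonneg (S9.hk_nonneg _ _) (by norm_num)))

/-- The box. -/
noncomputable def S9.Box (R Q : ℕ) : Finset (ℤ × ℤ × ℤ × ℤ) :=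
  Finset.Icc (0 : ℤ) R ×ˢ (Finset.Icc (0 : ℤ) R ×ˢ (Finset.Icc (0 : ℤ) Q ×ˢ Finset.Icc (0 : ℤ) Q))

theorem S9.sum_four (A B C D : Finset ℤ) (f g h k : ℤ → ℝ) :
    ∑ v ∈ A ×ˢ (B ×ˢ (C ×ˢ D)), f v.1 * (g v.2.1 * (h v.2.2.1 * k v.2.2.2))
      = (∑ a ∈ A, f a) * ((∑ a ∈ B, g a) * ((∑ a ∈ C, h a) * (∑ a ∈ D, k a))) := by
  simp only [Finset.sum_product, ← Finset.mul_sum, ← Finset.sum_mul]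

theorem S9.sum_bk (R Q : ℕ) (hQ : 1 ≤ Q) (H : ℝ) (hR : 2 * (1 + Real.log (R + 1)) ≤ H)
    (hQH : 2 * (1 + Real.log (Q + 1)) ≤ H)
    (v' : ℤ × ℤ × ℤ × ℤ) (hv' : v' ∈ S9.Box R Q) :
    ∑ v ∈ S9.Box R Q, S9.bk Q v v' ≤ 45 * H ^ 2 := by
  unfold S9.Box at hv' ⊢
  simp only [Finset.mem_product] at hv'
  obtain ⟨h1, h2, h3, h4⟩ := hv'
  unfold S9.bk
  rw [Finset.sum_add_distrib, ← Finset.mul_sum,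
    S9.sum_four _ _ _ _ (fun a => S9.nk a v'.1) (fun a => S9.nk a v'.2.1)
      (fun a => S9.hk a v'.2.2.1) (fun a => S9.hk a v'.2.2.2),
    S9.sum_four _ _ _ _ (fun a => S9.hk a v'.1) (fun a => S9.hk a v'.2.1)
      (fun a => 1) (fun a => 1)]
  have n1 := S9.sum_nk R v'.1
  have n2 := S9.sum_nk R v'.2.1
  have k1 := (S9.sum_hk R _ h1).trans hR
  have k2 := (S9.sum_hk R _ h2).trans hR
  have k3 := (S9.sum_hk Q _ h3).trans hQH
  have k4 := (S9.sum_hk Q _ h4).trans hQH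
  have pos : ∀ (s : Finset ℤ) b, 0 ≤ ∑ a ∈ s, S9.hk a b :=
    fun s b => Finset.sum_nonneg fun a _ => S9.hk_nonneg _ _
  have posn : ∀ (s : Finset ℤ) b, 0 ≤ ∑ a ∈ s, S9.nk a b :=
    fun s b => Finset.sum_nonneg fun a _ => S9.nk_nonneg _ _
  have hH : 0 ≤ H := le_trans (pos _ _) k1
  have hq : (∑ a ∈ Finset.Icc (0 : ℤ) Q, (1 : ℝ)) ≤ 2 * Q := by
    rw [Finset.sum_const, Int.card_Icc]
    simp only [sub_zero, nsmul_eq_mul, mul_one]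
    have : ((Q : ℤ) + 1).toNat = Q + 1 := by omega
    rw [this]
    have : (1 : ℝ) ≤ Q := by exact_mod_cast hQ
    push_cast; linarith
  have hq0 : 0 ≤ (∑ a ∈ Finset.Icc (0 : ℤ) Q, (1 : ℝ)) := Finset.sum_nonneg fun _ _ => by norm_num
  have hQ0 : (0 : ℝ) < Q := by exact_mod_cast hQ
  have e1 : (∑ a ∈ Finset.Icc (0 : ℤ) R, S9.nk a v'.1) * ((∑ a ∈ Finset.Icc (0 : ℤ) R, S9.nk a v'.2.1) *
      ((∑ a ∈ Finset.Icc (0 : ℤ) Q, S9.hk a v'.2.2.1) * (∑ a ∈ Finset.Icc (0 : ℤ) Q, S9.hk a v'.2.2.2)))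
      ≤ 3 * (3 * (H * H)) := by
    gcongr
    · exact mul_nonneg (posn _ _) (mul_nonneg (pos _ _) (pos _ _))
    · exact mul_nonneg (pos _ _) (pos _ _)
    · exact pos _ _
  have e2 : (∑ a ∈ Finset.Icc (0 : ℤ) R, S9.hk a v'.1) * ((∑ a ∈ Finset.Icc (0 : ℤ) R, S9.hk a v'.2.1) *
      ((∑ a ∈ Finset.Icc (0 : ℤ) Q, (1 : ℝ)) * (∑ a ∈ Finset.Icc (0 : ℤ) Q, (1 : ℝ))))
      ≤ H * (H * ((2 * Q) * (2 * Q))) := by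
    gcongr
    · exact mul_nonneg (pos _ _) (mul_nonneg hq0 hq0)
  have e3 : 9 / (Q : ℝ) ^ 2 * (H * (H * ((2 * Q) * (2 * Q)))) = 36 * H ^ 2 := by
    field_simp; ring
  have e4 := mul_le_mul_of_nonneg_left e2 (by positivity : 0 ≤ 9 / (Q : ℝ) ^ 2)
  rw [e3] at e4
  nlinarith [e1, e4]

theorem S9.hk_div (Q : ℕ) (hQ : 1 ≤ Q) (x y : ℤ) (h : 2 ≤ |x / Q - y / Q|) :
    S9.hk x y ≤ 3 / Q * S9.hk (x / Q) (y / Q) := by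
  have hQ0 : (0 : ℝ) < Q := by exact_mod_cast hQ
  have hQz : (0 : ℤ) < Q := by exact_mod_cast hQ
  have key : (|x / Q - y / Q| - 1) * Q ≤ |x - y| := by
    have a1 := Int.emod_add_mul_ediv x Q
    have a2 := Int.emod_add_mul_ediv y Q
    have b1 := Int.emod_nonneg x hQz.ne'
    have b2 := Int.emod_nonneg y hQz.ne'
    have c1 := Int.emod_lt_of_pos x hQz
    have c2 := Int.emod_lt_of_pos y hQz
    rcases abs_cases (x / (Q : ℤ) - y / Q) with ⟨e, _⟩ | ⟨e, _⟩ <;> rw [e]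
    · have := le_abs_self (x - y); nlinarith
    · have := neg_abs_le (x - y); nlinarith
  unfold S9.hk
  have e1 : |((x / (Q : ℤ) : ℤ) : ℝ) - ((y / (Q : ℤ) : ℤ) : ℝ)| = ((|x / Q - y / Q| : ℤ) : ℝ) := by push_cast; rfl
  have e2 : |(x : ℝ) - y| = ((|x - y| : ℤ) : ℝ) := by push_cast; rfl
  rw [e1, e2]
  set d := |x / (Q : ℤ) - y / Q| with hd
  have kr : ((d : ℝ) - 1) * Q ≤ ((|x - y| : ℤ) : ℝ) := by exact_mod_cast key
  have dr : (2 : ℝ) ≤ d := by exact_mod_cast h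
  rw [div_mul_div_comm, div_le_div_iff₀ (by positivity) (by positivity)]
  nlinarith

theorem S9.exists_hk (Q : ℕ) (hQ : 1 ≤ Q) (x0 x1 x2 x3 y0 y1 y2 y3 : ℤ) :
    let B := S9.bk Q (x0 / Q, x1 / Q, x2, x3) (y0 / Q, y1 / Q, y2, y3)
    S9.hk x0 y0 ^ 2 ≤ B ∨ S9.hk x1 y1 ^ 2 ≤ B ∨ S9.hk x2 y2 ^ 2 ≤ B ∨ S9.hk x3 y3 ^ 2 ≤ B := by
  intro B
  have hQ0 : (0 : ℝ) < Q := by exact_mod_cast hQ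
  have H := S9.hk_nonneg
  by_cases hn : |x0 / (Q : ℤ) - y0 / Q| ≤ 1 ∧ |x1 / (Q : ℤ) - y1 / Q| ≤ 1
  · have hB : S9.hk x2 y2 * S9.hk x3 y3 ≤ B := by
      simp only [B, S9.bk, S9.nk, if_pos hn.1, if_pos hn.2, one_mul]
      have : 0 ≤ 9 / (Q : ℝ) ^ 2 * (S9.hk (x0 / Q) (y0 / Q) * (S9.hk (x1 / Q) (y1 / Q) * 1)) :=
        mul_nonneg (by positivity) (mul_nonneg (H _ _) (mul_nonneg (H _ _) (by norm_num)))
      linarith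
    rcases le_total (S9.hk x2 y2) (S9.hk x3 y3) with h | h
    · right; right; left; nlinarith [H x2 y2]
    · right; right; right; nlinarith [H x3 y3]
  · have hB : 9 / (Q : ℝ) ^ 2 * (S9.hk (x0 / Q) (y0 / Q) * S9.hk (x1 / Q) (y1 / Q)) ≤ B := by
      simp only [B, S9.bk, mul_one]
      have := mul_nonneg (S9.nk_nonneg (x0 / Q) (y0 / Q)) (mul_nonneg (S9.nk_nonneg (x1 / Q) (y1 / Q))
        (mul_nonneg (H x2 y2) (H x3 y3)))
      linarith
    have aux : ∀ a b x y : ℝ, 0 ≤ a → 0 ≤ x → x ≤ 3 / Q * a → a ≤ b → x ^ 2 ≤ 9 / (Q : ℝ) ^ 2 * (a * b) := by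
      intro a b x y ha hx h1 h2
      have e : 9 / (Q : ℝ) ^ 2 * (a * b) = (3 / Q * a) * (3 / Q * b) := by field_simp; ring
      rw [e, pow_two]
      have : 3 / Q * a ≤ 3 / Q * b := by gcongr
      exact mul_le_mul h1 (h1.trans this) hx (by positivity)
    have conv : ∀ a b c d : ℤ, |a - b| ≤ |c - d| → S9.hk c d ≤ S9.hk a b := by
      intro a b c d h
      unfold S9.hk
      have : |(a : ℝ) - b| ≤ |(c : ℝ) - d| := by exact_mod_cast h
      gcongr
    rcases le_total (|x0 / (Q : ℤ) - y0 / Q|) (|x1 / (Q : ℤ) - y1 / Q|) with h | h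
    · right; left
      refine le_trans ?_ hB
      rw [mul_comm (S9.hk (x0 / Q) (y0 / Q))]
      refine aux _ _ _ 0 (H _ _) (H _ _) (S9.hk_div Q hQ _ _ ?_) (conv _ _ _ _ h)
      by_contra hc
      exact hn ⟨by omega, by omega⟩
    · left
      refine le_trans ?_ hB
      refine aux _ _ _ 0 (H _ _) (H _ _) (S9.hk_div Q hQ _ _ ?_) (conv _ _ _ _ h)
      by_contra hc
      exact hn ⟨by omega, by omega⟩

theorem S9.tdiv_spec (Y p : ℤ) (hp : 1 ≤ p) : |Y - p * Y.tdiv p| < p := by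
  have h := Int.tmod_add_mul_tdiv Y p
  have : Y - p * Y.tdiv p = Y.tmod p := by linarith
  rw [this]
  have h2 := Int.tmod_lt_of_pos Y (by omega : 0 < p)
  have h3 := Int.tmod_lt_of_pos (-Y) (by omega : 0 < p)
  rw [Int.neg_tmod] at h3
  rw [abs_lt]
  omega

theorem S9.abs_tdiv_le (Y p : ℤ) (hp : 1 ≤ p) (B : ℤ) (h : |Y| ≤ B * p) : |Y.tdiv p| ≤ B := by
  have h1 := S9.tdiv_spec Y p hp
  rw [abs_lt] at h1
  rw [abs_le] at h ⊢
  constructor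
  · by_contra hc
    push Not at hc
    rcases le_or_gt 0 Y with h0 | h0
    · have := Int.tdiv_nonneg h0 (by omega : 0 ≤ p)
      have : 0 ≤ B := by nlinarith
      omega
    · have h2 : (-Y).tdiv p = - Y.tdiv p := Int.neg_tdiv Y p
      have h3 : (-Y).tdiv p ≤ B := by
        rw [Int.tdiv_eq_ediv_of_nonneg (by omega)]
        have := Int.ediv_le_ediv (c := p) (by omega) (by linarith : -Y ≤ B * p)
        rwa [Int.mul_ediv_cancel _ (by omega)] at this
      omega
  · rcases le_or_gt 0 Y with h0 | h0
    · rw [Int.tdiv_eq_ediv_of_nonneg h0]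
      have := Int.ediv_le_ediv (c := p) (by omega) h.2
      rwa [Int.mul_ediv_cancel _ (by omega)] at this
    · have h2 : (-Y).tdiv p = - Y.tdiv p := Int.neg_tdiv Y p
      have h3 := Int.tdiv_nonneg (by omega : 0 ≤ -Y) (by omega : 0 ≤ p)
      have : 0 ≤ B := by nlinarith
      omega

/-- Finite set of possible differences. -/
noncomputable def S9.Dset (p q : ℤ) (B : ℕ) : Finset ℤ :=
  (Finset.Icc (-(2 * B : ℤ)) (2 * B) ×ˢ Finset.Icc (-2 : ℤ) 2).image
    (fun s => q * (p * s.1 / q + s.2))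

theorem S9.card_Dset (p q : ℤ) (B : ℕ) : (S9.Dset p q B).card ≤ (4 * B + 1) * 5 := by
  unfold S9.Dset
  refine Finset.card_image_le.trans ?_
  rw [Finset.card_product, Int.card_Icc, Int.card_Icc]
  refine Nat.mul_le_mul (by omega) (by norm_num)

theorem S9.near_ediv (a k q : ℤ) (hq : 1 ≤ q) (N : ℤ) (h : |q * k - a| ≤ N * q) :
    k - a / q ∈ Finset.Icc (-N) (N + 1) := by
  have h1 := Int.emod_add_mul_ediv a q
  have h2 := Int.emod_nonneg a (by omega : q ≠ 0)
  have h3 := Int.emod_lt_of_pos a (by omega : 0 < q)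
  rw [abs_le] at h
  rw [Finset.mem_Icc]
  constructor
  · have : q * (a / q - N) ≤ q * k := by nlinarith
    have := le_of_mul_le_mul_left this (by omega : 0 < q)
    omega
  · have : q * k < q * (a / q + N + 1) := by nlinarith
    have := lt_of_mul_lt_mul_left this (by omega : 0 ≤ q)
    omega

theorem S9.mem_Dset (p q : ℤ) (hp : 1 ≤ p) (hq : 1 ≤ q) (B : ℕ) (Y Y' : ℤ)
    (hY : |Y| ≤ B * p) (hY' : |Y'| ≤ B * p)
    (hL : Y - q * Y.tdiv q = Y' - q * Y'.tdiv q)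
    (hM : (Y - p * Y.tdiv p).tdiv q = (Y' - p * Y'.tdiv p).tdiv q) :
    Y - Y' ∈ S9.Dset p q B := by
  have s1 := S9.abs_tdiv_le Y p hp B hY
  have s2 := S9.abs_tdiv_le Y' p hp B hY'
  have r1 := S9.tdiv_spec (Y - p * Y.tdiv p) q hq
  have r2 := S9.tdiv_spec (Y' - p * Y'.tdiv p) q hq
  rw [hM] at r1
  set m := (Y' - p * Y'.tdiv p).tdiv q
  set s := Y.tdiv p
  set s' := Y'.tdiv p
  set k := Y.tdiv q - Y'.tdiv q with hk
  have e : Y - Y' = q * k := by rw [hk]; linarith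
  have hj : |q * k - p * (s - s')| < 2 * q := by
    rw [← e]
    rw [abs_lt] at *
    constructor <;> linarith [r1.1, r1.2, r2.1, r2.2]
  rw [e]
  unfold S9.Dset
  rw [Finset.mem_image]
  refine ⟨(s - s', k - p * (s - s') / q), ?_, by ring⟩
  rw [Finset.mem_product]
  constructor
  · simp only [Finset.mem_Icc]
    rw [abs_le] at s1 s2
    omega
  · dsimp only
    have h1 := Int.emod_add_mul_ediv (p * (s - s')) q
    have h2 := Int.emod_nonneg (p * (s - s')) (by omega : q ≠ 0)
    have h3 := Int.emod_lt_of_pos (p * (s - s')) (by omega : 0 < q)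
    rw [abs_lt] at hj
    generalize p * (s - s') / q = w at *
    rw [Finset.mem_Icc]
    constructor
    · have : q * (w - 2) < q * k := by linarith
      have := lt_of_mul_lt_mul_left this (by omega : 0 ≤ q)
      omega
    · have : q * k < q * (w + 3) := by linarith
      have := lt_of_mul_lt_mul_left this (by omega : 0 ≤ q)
      omega

/-- Finite set of possible middle parts. -/
noncomputable def S9.Mset (p q Y0 : ℤ) (B B' : ℕ) : Finset ℤ :=
  (Finset.Icc (-(B : ℤ)) B ×ˢ Finset.Icc (-(B' + 1 : ℤ)) (B' + 2)).image
    (fun s => (Y0 - p * s.1) / q + s.2)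

theorem S9.card_Mset (p q Y0 : ℤ) (B B' : ℕ) :
    (S9.Mset p q Y0 B B').card ≤ (2 * B + 1) * (2 * B' + 4) := by
  unfold S9.Mset
  refine Finset.card_image_le.trans ?_
  rw [Finset.card_product, Int.card_Icc, Int.card_Icc]
  refine Nat.mul_le_mul (by omega) (by omega)

theorem S9.mem_Mset (p q : ℤ) (hp : 1 ≤ p) (hq : 1 ≤ q) (B B' : ℕ) (Y Y0 : ℤ)
    (hY : |Y| ≤ B * p) (hd : |Y - Y0| ≤ B' * q) :
    (Y - p * Y.tdiv p).tdiv q ∈ S9.Mset p q Y0 B B' := by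
  have s1 := S9.abs_tdiv_le Y p hp B hY
  have r1 := S9.tdiv_spec (Y - p * Y.tdiv p) q hq
  set m := (Y - p * Y.tdiv p).tdiv q
  set s := Y.tdiv p
  have hh : |q * m - (Y0 - p * s)| ≤ (B' + 1) * q := by
    rw [abs_lt] at r1
    rw [abs_le] at *
    constructor <;> linarith [r1.1, r1.2]
  have := S9.near_ediv _ _ _ hq _ hh
  unfold S9.Mset
  rw [Finset.mem_image]
  refine ⟨(s, m - (Y0 - p * s) / q), ?_, by ring⟩
  rw [Finset.mem_product]
  refine ⟨?_, ?_⟩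
  · simp only [Finset.mem_Icc]; rw [abs_le] at s1; exact s1
  · convert this using 2; ring

theorem S9.one_le_pbar (P lam : ℝ) (hP : 2 ≤ P) (hl : 0 ≤ lam) : 1 ≤ pbar P lam := by
  unfold pbar
  rw [Int.le_floor]
  push_cast
  exact Real.one_le_rpow (by linarith) (by linarith)

theorem S9.midPart_bounds (P lo : ℝ) (hP : 2 ≤ P) (hlo : 0 ≤ lo) (x : ℤ) (hx : 0 ≤ x) :
    0 ≤ midPart P lo 1 x ∧ midPart P lo 1 x ≤ pbar P 1 ∧
      midPart P lo 1 x * pbar P lo ≤ pbar P 1 := by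
  have hp := S9.one_le_pbar P 1 hP (by norm_num)
  have hq := S9.one_le_pbar P lo hP hlo
  have e : lowPart P 1 x = x % pbar P 1 := by
    unfold lowPart
    rw [Int.tdiv_eq_ediv_of_nonneg hx]
    have := Int.emod_add_mul_ediv x (pbar P 1)
    linarith
  have h2 := Int.emod_nonneg x (by omega : pbar P 1 ≠ 0)
  have h3 := Int.emod_lt_of_pos x (by omega : 0 < pbar P 1)
  unfold midPart
  rw [e, Int.tdiv_eq_ediv_of_nonneg h2]
  have h4 := Int.ediv_nonneg h2 (by omega : 0 ≤ pbar P lo)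
  have h5 := Int.ediv_mul_le (x % pbar P 1) (by omega : pbar P lo ≠ 0)
  refine ⟨h4, ?_, by linarith⟩
  nlinarith

theorem S9.mid_half_le (P : ℝ) (hP : 2 ≤ P) (x : ℤ) (hx : 0 ≤ x) :
    midPart P (1/2) 1 x ≤ (⌊2 * P ^ (1/4 : ℝ)⌋₊ : ℤ) := by
  obtain ⟨h0, -, h1⟩ := S9.midPart_bounds P (1/2) hP (by norm_num) x hx
  set z := midPart P (1/2) 1 x
  have hs : (1 : ℝ) ≤ P ^ (1/4 : ℝ) := Real.one_le_rpow (by linarith) (by norm_num)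
  have e1 : P ^ ((1 : ℝ)/2) = P ^ (1/4 : ℝ) * P ^ (1/4 : ℝ) := by
    rw [← Real.rpow_add (by linarith)]; norm_num
  have f1 : (pbar P 1 : ℝ) ≤ P ^ ((1 : ℝ)/2) := Int.floor_le _
  have f2 : P ^ ((1/4 : ℝ)) < pbar P (1/2) + 1 := by
    have := Int.lt_floor_add_one (P ^ ((1/2 : ℝ)/2))
    unfold pbar
    rw [show (1/4 : ℝ) = 1/2/2 by norm_num]
    exact this
  have f3 : (1 : ℝ) ≤ pbar P (1/2) := by exact_mod_cast S9.one_le_pbar P (1/2) hP (by norm_num)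
  have h1r : (z : ℝ) * pbar P (1/2) ≤ pbar P 1 := by exact_mod_cast h1
  have h0r : (0 : ℝ) ≤ z := by exact_mod_cast h0
  have hz : (z : ℝ) ≤ 2 * P ^ (1/4 : ℝ) := by
    set s := P ^ (1/4 : ℝ)
    rw [e1] at f1
    by_contra hc
    push Not at hc
    have : 2 * (pbar P (1/2) : ℝ) ≥ s := by linarith
    nlinarith
  have hn : (z.toNat : ℤ) = z := Int.toNat_of_nonneg h0
  rw [← hn]
  norm_cast
  apply Nat.le_floor
  have : ((z.toNat : ℤ) : ℝ) = z := by rw [hn]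
  push_cast at this
  rw [this]; exact hz

theorem S9.Q_le (P : ℝ) (hP : 2 ≤ P) :
    1 ≤ ⌊2 * P ^ (1/4 : ℝ)⌋₊ ∧ (⌊2 * P ^ (1/4 : ℝ)⌋₊ : ℝ) ≤ 4 * (pbar P (2/3) : ℝ) := by
  have hs : (1 : ℝ) ≤ P ^ (1/4 : ℝ) := Real.one_le_rpow (by linarith) (by norm_num)
  refine ⟨Nat.le_floor (by push_cast; linarith), (Nat.floor_le (by positivity)).trans ?_⟩
  have f3 : (1 : ℝ) ≤ pbar P (2/3) := by exact_mod_cast S9.one_le_pbar P (2/3) hP (by norm_num)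
  have f2 : P ^ ((1/3 : ℝ)) < pbar P (2/3) + 1 := by
    have := Int.lt_floor_add_one (P ^ ((2/3 : ℝ)/2))
    unfold pbar
    rw [show (1/3 : ℝ) = 2/3/2 by norm_num]
    exact this
  have : P ^ (1/4 : ℝ) ≤ P ^ (1/3 : ℝ) :=
    Real.rpow_le_rpow_of_exponent_le (by linarith) (by norm_num)
  linarith

theorem S9.log_bounds (P : ℝ) (hP : 2 ≤ P) :
    2 * (1 + Real.log ((⌊2 * P ^ (1/4 : ℝ)⌋₊ : ℝ) + 1)) ≤ 6 * (1 + Real.log P) ∧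
    2 * (1 + Real.log (((pbar P 1).toNat : ℝ) + 1)) ≤ 6 * (1 + Real.log P) := by
  have hl : 0 ≤ Real.log P := Real.log_nonneg (by linarith)
  have aux : ∀ t : ℝ, 0 ≤ t → t ≤ 2 * P → 2 * (1 + Real.log (t + 1)) ≤ 6 * (1 + Real.log P) := by
    intro t h0 ht
    have : Real.log (t + 1) ≤ Real.log (P ^ 3) :=
      Real.log_le_log (by linarith) (by nlinarith [sq_nonneg (P - 2)])
    rw [Real.log_pow] at this
    push_cast at this
    linarith
  refine ⟨aux _ (by positivity) ((Nat.floor_le (by positivity)).trans ?_), aux _ (by positivity) ?_⟩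
  · have : P ^ (1/4 : ℝ) ≤ P ^ (1 : ℝ) :=
      Real.rpow_le_rpow_of_exponent_le (by linarith) (by norm_num)
    rw [Real.rpow_one] at this; linarith
  · have h1 := S9.one_le_pbar P 1 hP (by norm_num)
    have h2 : (((pbar P 1).toNat : ℤ) : ℝ) = pbar P 1 := by rw [Int.toNat_of_nonneg (by omega)]
    push_cast at h2
    rw [h2]
    have f1 : (pbar P 1 : ℝ) ≤ P ^ ((1 : ℝ)/2) := Int.floor_le _
    have : P ^ (1/2 : ℝ) ≤ P ^ (1 : ℝ) :=
      Real.rpow_le_rpow_of_exponent_le (by linarith) (by norm_num)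
    rw [Real.rpow_one] at this; linarith

/-- The seven integer inputs at one time. -/
noncomputable def S9.e7 (P : ℝ) {n : ℕ} (x1 x2 : Fin 5 × Fin n → ℤ) (t : Fin n) : Fin 7 → ℤ :=
  ![x1 (3, t), x1 (4, t), midPart P (1/4) 1 (x2 (0, t)), midPart P (1/4) 1 (x2 (1, t)),
    midPart P (1/2) 1 (x2 (2, t)), midPart P (1/2) 1 (x2 (3, t)), midPart P (1/2) 1 (x2 (4, t))]

/-- The output as a function of the second input and the rest. -/
noncomputable def S9.YY (P : ℝ) {n : ℕ} {ι : Type} (idx : Fin 2 → Fin n → Fin 7 → ι)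
    (x : Fin 5 × Fin n → ℤ) (w : (Fin 5 × Fin n → ℤ) × (ι → ℝ)) (q : Fin 2 × Fin n) : ℤ :=
  ∑ i : Fin 7, truncZ (w.2 (idx q.1 q.2 i) * (S9.e7 P w.1 x q.2 i : ℝ))

theorem S9.measurable_YY (P : ℝ) {n : ℕ} {ι : Type} (idx : Fin 2 → Fin n → Fin 7 → ι)
    (x : Fin 5 × Fin n → ℤ) : Measurable (S9.YY P idx x) := by
  refine measurable_pi_lambda _ fun q => ?_
  unfold S9.YY
  refine Finset.measurable_sum _ fun i _ => S9.measurable_truncZ.comp (Measurable.mul ?_ ?_)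
  · exact (measurable_pi_apply _).comp measurable_snd
  · refine (measurable_of_countable (fun z : ℤ => (z : ℝ))).comp ?_
    have h : ∀ j, Measurable (fun w : (Fin 5 × Fin n → ℤ) × (ι → ℝ) => w.1 j) :=
      fun j => (measurable_pi_apply j).comp measurable_fst
    fin_cases i <;> simp only [S9.e7]
    · exact h _
    · exact h _
    all_goals exact measurable_const

theorem S9.e7_bounds (P : ℝ) (hP : 2 ≤ P) {n : ℕ} (x1 x2 : Fin 5 × Fin n → ℤ)
    (h1 : ∀ j, 0 ≤ x1 j ∧ x1 j ≤ pbar P 1) (h2 : ∀ j, 0 ≤ x2 j ∧ x2 j ≤ pbar P 1)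
    (t : Fin n) (i : Fin 7) : 0 ≤ S9.e7 P x1 x2 t i ∧ S9.e7 P x1 x2 t i ≤ pbar P 1 := by
  have a := fun j => S9.midPart_bounds P (1/4) hP (by norm_num) (x2 j) (h2 j).1
  have b := fun j => S9.midPart_bounds P (1/2) hP (by norm_num) (x2 j) (h2 j).1
  fin_cases i
  · exact h1 _
  · exact h1 _
  · exact ⟨(a _).1, (a _).2.1⟩
  · exact ⟨(a _).1, (a _).2.1⟩
  · exact ⟨(b _).1, (b _).2.1⟩
  · exact ⟨(b _).1, (b _).2.1⟩
  · exact ⟨(b _).1, (b _).2.1⟩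

theorem S9.abs_YY (P : ℝ) (hP : 2 ≤ P) {n : ℕ} {ι : Type} (idx : Fin 2 → Fin n → Fin 7 → ι)
    (x : Fin 5 × Fin n → ℤ) (w : (Fin 5 × Fin n → ℤ) × (ι → ℝ))
    (h1 : ∀ j, 0 ≤ w.1 j ∧ w.1 j ≤ pbar P 1) (h2 : ∀ j, 0 ≤ x j ∧ x j ≤ pbar P 1)
    (Δ₂ : ℝ) (hΔ : 0 ≤ Δ₂) (hg : ∀ k t i, |w.2 (idx k t i)| ≤ Δ₂) (q : Fin 2 × Fin n) :
    |S9.YY P idx x w q| ≤ (⌈7 * Δ₂⌉₊ : ℤ) * pbar P 1 := by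
  have hp : (1 : ℝ) ≤ pbar P 1 := by exact_mod_cast S9.one_le_pbar P 1 hP (by norm_num)
  have h : |(S9.YY P idx x w q : ℝ)| ≤ 7 * Δ₂ * pbar P 1 := by
    unfold S9.YY
    push_cast
    refine (Finset.abs_sum_le_sum_abs _ _).trans ?_
    have : ∀ i ∈ (Finset.univ : Finset (Fin 7)),
        |((truncZ (w.2 (idx q.1 q.2 i) * (S9.e7 P w.1 x q.2 i : ℝ)) : ℤ) : ℝ)| ≤ Δ₂ * pbar P 1 := by
      intro i _
      refine (S9.abs_truncZ_le _).trans ?_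
      rw [abs_mul]
      obtain ⟨a, b⟩ := S9.e7_bounds P hP w.1 x h1 h2 q.2 i
      have a' : (0 : ℝ) ≤ S9.e7 P w.1 x q.2 i := by exact_mod_cast a
      have b' : (S9.e7 P w.1 x q.2 i : ℝ) ≤ pbar P 1 := by exact_mod_cast b
      rw [abs_of_nonneg a']
      exact mul_le_mul (hg _ _ _) b' a' hΔ
    refine (Finset.sum_le_sum this).trans ?_
    simp; linarith
  have h' : |(S9.YY P idx x w q : ℝ)| ≤ (⌈7 * Δ₂⌉₊ : ℝ) * pbar P 1 :=
    h.trans (mul_le_mul_of_nonneg_right (Nat.le_ceil _) (by linarith))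
  exact_mod_cast h'

theorem S9.abs_YY_sub (P : ℝ) (hP : 2 ≤ P) {n : ℕ} {ι : Type} (idx : Fin 2 → Fin n → Fin 7 → ι)
    (x y : Fin 5 × Fin n → ℤ) (w : (Fin 5 × Fin n → ℤ) × (ι → ℝ))
    (Δ₂ : ℝ) (hΔ : 0 ≤ Δ₂) (hg : ∀ k t i, |w.2 (idx k t i)| ≤ Δ₂) (q : Fin 2 × Fin n)
    (hd : ∀ i, |S9.e7 P w.1 x q.2 i - S9.e7 P w.1 y q.2 i| ≤ (⌊2 * P ^ (1/4 : ℝ)⌋₊ : ℤ)) :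
    |S9.YY P idx x w q - S9.YY P idx y w q| ≤ (⌈28 * (Δ₂ + 2)⌉₊ : ℤ) * pbar P (2/3) := by
  obtain ⟨Q1, Q2⟩ := S9.Q_le P hP
  set Q := ⌊2 * P ^ (1/4 : ℝ)⌋₊
  have hq : (1 : ℝ) ≤ pbar P (2/3) := by exact_mod_cast S9.one_le_pbar P (2/3) hP (by norm_num)
  have Q1' : (1 : ℝ) ≤ Q := by exact_mod_cast Q1
  have h : |(S9.YY P idx x w q : ℝ) - S9.YY P idx y w q| ≤ 7 * ((Δ₂ + 2) * Q) := by
    unfold S9.YY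
    push_cast
    rw [← Finset.sum_sub_distrib]
    refine (Finset.abs_sum_le_sum_abs _ _).trans ?_
    have : ∀ i ∈ (Finset.univ : Finset (Fin 7)),
        |((truncZ (w.2 (idx q.1 q.2 i) * (S9.e7 P w.1 x q.2 i : ℝ)) : ℤ) : ℝ)
          - ((truncZ (w.2 (idx q.1 q.2 i) * (S9.e7 P w.1 y q.2 i : ℝ)) : ℤ) : ℝ)|
          ≤ (Δ₂ + 2) * Q := by
      intro i _
      have a := S9.abs_truncZ_sub (w.2 (idx q.1 q.2 i) * (S9.e7 P w.1 x q.2 i : ℝ))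
      have b := S9.abs_truncZ_sub (w.2 (idx q.1 q.2 i) * (S9.e7 P w.1 y q.2 i : ℝ))
      have c : |w.2 (idx q.1 q.2 i) * (S9.e7 P w.1 x q.2 i : ℝ)
          - w.2 (idx q.1 q.2 i) * (S9.e7 P w.1 y q.2 i : ℝ)| ≤ Δ₂ * Q := by
        rw [← mul_sub, abs_mul]
        have d : |(S9.e7 P w.1 x q.2 i : ℝ) - S9.e7 P w.1 y q.2 i| ≤ Q := by exact_mod_cast hd i
        exact mul_le_mul (hg _ _ _) d (abs_nonneg _) hΔ
      rw [abs_le] at *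
      constructor <;> nlinarith [a.1, a.2, b.1, b.2, c.1, c.2]
    refine (Finset.sum_le_sum this).trans ?_
    simp
  have h' : |(S9.YY P idx x w q : ℝ) - S9.YY P idx y w q|
      ≤ (⌈28 * (Δ₂ + 2)⌉₊ : ℝ) * pbar P (2/3) := by
    refine h.trans (le_trans ?_ (mul_le_mul_of_nonneg_right (Nat.le_ceil _) (by linarith)))
    have : (Δ₂ + 2) * Q ≤ (Δ₂ + 2) * (4 * pbar P (2/3)) := by gcongr
    linarith
  exact_mod_cast h'

/-- The auxiliary quadruple. -/
noncomputable def S9.VV (P : ℝ) {n : ℕ} (Q : ℕ) (j1 j2 : Fin 7) (x : Fin 5 × Fin n → ℤ) (t : Fin n) :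
    ℤ × ℤ × ℤ × ℤ :=
  (S9.e7 P 0 x t 2 / Q, S9.e7 P 0 x t 3 / Q, S9.e7 P 0 x t j1, S9.e7 P 0 x t j2)

theorem S9.VV_mem (P : ℝ) (hP : 2 ≤ P) {n : ℕ} (j1 j2 : Fin 7) (h1 : 4 ≤ j1) (h2 : 4 ≤ j2)
    (x : Fin 5 × Fin n → ℤ) (hx : ∀ j, 0 ≤ x j ∧ x j ≤ pbar P 1) (t : Fin n) :
    S9.VV P ⌊2 * P ^ (1/4 : ℝ)⌋₊ j1 j2 x t ∈ S9.Box (pbar P 1).toNat ⌊2 * P ^ (1/4 : ℝ)⌋₊ := by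
  have hp := S9.one_le_pbar P 1 hP (by norm_num)
  obtain ⟨Q1, -⟩ := S9.Q_le P hP
  have hb := S9.e7_bounds P hP 0 x (fun j => ⟨le_rfl, by simp; omega⟩) hx t
  have hm := fun j => S9.mid_half_le P hP (x j) (hx j).1
  set Q := ⌊2 * P ^ (1/4 : ℝ)⌋₊
  have aux : ∀ j : Fin 7, 4 ≤ j → S9.e7 P 0 x t j ≤ Q := by
    intro j hj
    fin_cases j
    · simp at hj
    · exact absurd hj (by decide)
    · exact absurd hj (by decide)
    · exact absurd hj (by decide)
    · exact hm _
    · exact hm _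
    · exact hm _
  have aux2 : ∀ j, S9.e7 P 0 x t j / Q ∈ Finset.Icc (0 : ℤ) (pbar P 1).toNat := by
    intro j
    rw [Finset.mem_Icc, Int.toNat_of_nonneg (by omega)]
    refine ⟨Int.ediv_nonneg (hb j).1 (by omega), ?_⟩
    exact (Int.ediv_le_self _ (hb j).1).trans (hb j).2
  unfold S9.Box S9.VV
  simp only [Finset.mem_product]
  refine ⟨aux2 _, aux2 _, Finset.mem_Icc.2 ⟨(hb _).1, aux _ h1⟩, Finset.mem_Icc.2 ⟨(hb _).1, aux _ h2⟩⟩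

theorem S9.e7_indep (P : ℝ) {n : ℕ} (x1 x y : Fin 5 × Fin n → ℤ) (t : Fin n) (i : Fin 7) (g : ℝ) :
    truncZ (g * (S9.e7 P x1 x t i : ℝ)) - truncZ (g * (S9.e7 P x1 y t i : ℝ))
      = truncZ (g * (S9.e7 P 0 x t i : ℝ)) - truncZ (g * (S9.e7 P 0 y t i : ℝ)) := by
  fin_cases i <;> simp [S9.e7]

/-- the low and middle parts jointly -/
noncomputable def S9.LM (P : ℝ) {n : ℕ} {ι : Type} (idx : Fin 2 → Fin n → Fin 7 → ι)
    (x : Fin 5 × Fin n → ℤ) (w : (Fin 5 × Fin n → ℤ) × (ι → ℝ)) :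
    (Fin 2 × Fin n → ℤ) × (Fin 2 × Fin n → ℤ) :=
  (fun q => lowPart P (2/3) (S9.YY P idx x w q), fun q => midPart P (2/3) 1 (S9.YY P idx x w q))

theorem S9.hb_lemma (P : ℝ) (hP : 2 ≤ P) (n : ℕ) (hn : 1 ≤ n) {Ω ι : Type} [MeasurableSpace Ω]
    [DecidableEq ι] (μ : Measure Ω) [IsProbabilityMeasure μ] (G : ι → Ω → ℝ)
    (hG : ∀ i, Measurable (G i)) (Δ₁ Δ₂ fmax : ℝ) (hΔ : 0 ≤ Δ₂) (hf : 0 ≤ fmax)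
    (hB : BoundedDensityFamily μ G Δ₁ Δ₂ fmax)
    (idx : Fin 2 → Fin n → Fin 7 → ι)
    (hidx : Function.Injective (fun p : Fin 2 × Fin n × Fin 7 => idx p.1 p.2.1 p.2.2))
    (X1 : Ω → Fin 5 × Fin n → ℤ) (hX1 : ∀ ω j, 0 ≤ X1 ω j ∧ X1 ω j ≤ pbar P 1)
    (j1 j2 : Fin 7) (x y : Fin 5 × Fin n → ℤ) (hx : ∀ j, 0 ≤ x j ∧ x j ≤ pbar P 1)
    (hy : ∀ j, 0 ≤ y j ∧ y j ≤ pbar P 1) :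
    μ.real {ω | S9.LM P idx y (X1 ω, fun i => G i ω) = S9.LM P idx x (X1 ω, fun i => G i ω)}
      ≤ ∏ t, ((fmax ^ 7 * ((8 * ((4 * (⌈7 * Δ₂⌉₊ : ℝ) + 1) * 5) + 2 * Δ₂) * (2 * Δ₂) ^ 6)) ^ 2
        * S9.bk ⌊2 * P ^ (1/4 : ℝ)⌋₊ (S9.VV P ⌊2 * P ^ (1/4 : ℝ)⌋₊ j1 j2 x t)
          (S9.VV P ⌊2 * P ^ (1/4 : ℝ)⌋₊ j1 j2 y t)) := by
  obtain ⟨Q1, -⟩ := S9.Q_le P hP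
  set Q := ⌊2 * P ^ (1/4 : ℝ)⌋₊
  set B := ⌈7 * Δ₂⌉₊
  set D := S9.Dset (pbar P 1) (pbar P (2/3)) B with hD
  have hc : (D.card : ℝ) ≤ (4 * (B : ℝ) + 1) * 5 := by
    exact_mod_cast S9.card_Dset (pbar P 1) (pbar P (2/3)) B
  have hex : ∀ t, ∃ i : Fin 7, S9.hk (S9.e7 P 0 x t i) (S9.e7 P 0 y t i) ^ 2
      ≤ S9.bk Q (S9.VV P Q j1 j2 x t) (S9.VV P Q j1 j2 y t) := by
    intro t
    rcases S9.exists_hk Q Q1 (S9.e7 P 0 x t 2) (S9.e7 P 0 x t 3) (S9.e7 P 0 x t j1)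
      (S9.e7 P 0 x t j2) (S9.e7 P 0 y t 2) (S9.e7 P 0 y t 3) (S9.e7 P 0 y t j1)
      (S9.e7 P 0 y t j2) with h | h | h | h
    · exact ⟨_, h⟩
    · exact ⟨_, h⟩
    · exact ⟨_, h⟩
    · exact ⟨_, h⟩
  choose i hi using hex
  have hpr := S9.prob_le μ G hG Δ₁ Δ₂ fmax hΔ hf hB n hn idx hidx D (S9.e7 P 0 x) (S9.e7 P 0 y)
    (fun t => S9.hk (S9.e7 P 0 x t (i t)) (S9.e7 P 0 y t (i t))) (fun t => ⟨i t, le_rfl⟩)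
  have hae : ∀ᵐ ω ∂μ, ∀ k t i, |G (idx k t i) ω| ≤ Δ₂ := by
    rw [ae_all_iff]; intro k; rw [ae_all_iff]; intro t; rw [ae_all_iff]; intro i
    filter_upwards [hB.1 (idx k t i)] with ω h using h.2
  refine le_trans ?_ (hpr.trans ?_)
  · refine ENNReal.toReal_mono (measure_ne_top _ _) (measure_mono_ae ?_)
    filter_upwards [hae] with ω hω hLM
    refine ⟨hω, fun k t => ?_⟩
    have hLM' : S9.LM P idx y (X1 ω, fun i => G i ω) = S9.LM P idx x (X1 ω, fun i => G i ω) := hLM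
    have e : ∑ i, (truncZ (G (idx k t i) ω * S9.e7 P 0 x t i)
        - truncZ (G (idx k t i) ω * S9.e7 P 0 y t i))
        = S9.YY P idx x (X1 ω, fun i => G i ω) (k, t) - S9.YY P idx y (X1 ω, fun i => G i ω) (k, t) := by
      unfold S9.YY
      rw [← Finset.sum_sub_distrib]
      exact Finset.sum_congr rfl fun i _ => (S9.e7_indep P (X1 ω) x y t i _).symm
    rw [e]
    have hl := congrFun (congrArg Prod.fst hLM') (k, t)
    have hm := congrFun (congrArg Prod.snd hLM') (k, t)
    refine S9.mem_Dset _ _ (S9.one_le_pbar P 1 hP (by norm_num))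
      (S9.one_le_pbar P (2/3) hP (by norm_num)) B _ _
      (S9.abs_YY P hP idx x _ (hX1 ω) hx Δ₂ hΔ hω _)
      (S9.abs_YY P hP idx y _ (hX1 ω) hy Δ₂ hΔ hω _) hl.symm hm.symm
  · refine Finset.prod_le_prod (fun t _ => sq_nonneg _) fun t _ => ?_
    rw [mul_pow]
    refine mul_le_mul ?_ (hi t) (sq_nonneg _) (sq_nonneg _)
    gcongr

theorem S9.Ent_const {X α : Type*} [Fintype X] {p : X → ℝ} (h1 : ∑ x, p x = 1) (a : α) :
    S9.Ent p (fun _ => a) = 0 := by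
  unfold S9.Ent S9.mass
  simp [h1]

theorem S9.sum_law {Ω X : Type*} [MeasurableSpace Ω] (μ : Measure Ω)
    [IsProbabilityMeasure μ] [Fintype X] [MeasurableSpace X] [MeasurableSingletonClass X]
    (V : Ω → X) (hV : Measurable V) : ∑ x, μ.real (V ⁻¹' {x}) = 1 := by
  have := sum_measureReal_preimage_singleton (μ := μ) (f := V) Finset.univ
    (fun y _ => hV (measurableSet_singleton y))
  rw [this]
  simp

theorem S9.count_lemma (P : ℝ) (hP : 2 ≤ P) {n : ℕ} {ι X : Type} [Fintype X] {p : X → ℝ}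
    (hp : ∀ x, 0 ≤ p x) (h1 : ∑ x, p x = 1) (v : X → Fin 5 × Fin n → ℤ)
    (hv : ∀ x j, 0 ≤ v x j ∧ v x j ≤ pbar P 1)
    (idx : Fin 2 → Fin n → Fin 7 → ι) (w : (Fin 5 × Fin n → ℤ) × (ι → ℝ))
    (hw : ∀ j, 0 ≤ w.1 j ∧ w.1 j ≤ pbar P 1)
    (Δ₂ : ℝ) (hΔ : 0 ≤ Δ₂) (hg : ∀ k t i, |w.2 (idx k t i)| ≤ Δ₂) :
    S9.Ent p (fun x => (S9.LM P idx (v x) w).2)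
      ≤ S9.Ent p (fun x (t : Fin n) => (S9.e7 P 0 (v x) t 2 / (⌊2 * P ^ (1/4 : ℝ)⌋₊ : ℤ),
          S9.e7 P 0 (v x) t 3 / (⌊2 * P ^ (1/4 : ℝ)⌋₊ : ℤ)))
        + n * (2 * Real.log ((2 * (⌈7 * Δ₂⌉₊ : ℝ) + 1) * (2 * (⌈28 * (Δ₂ + 2)⌉₊ : ℝ) + 4))) := by
  classical
  obtain ⟨Q1, -⟩ := S9.Q_le P hP
  have hmem := fun (x : X) => S9.VV_mem P hP (n := n) 4 5 (by decide) (by decide) (v x) (hv x)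
  have hmem' := fun (x : X) => S9.VV_mem P hP (n := n) 6 6 (by decide) (by decide) (v x) (hv x)
  set Q := ⌊2 * P ^ (1/4 : ℝ)⌋₊
  set B := ⌈7 * Δ₂⌉₊
  set B' := ⌈28 * (Δ₂ + 2)⌉₊
  set C : ℝ := (2 * (B : ℝ) + 1) * (2 * (B' : ℝ) + 4) with hC
  have hC0 : 0 < C := by positivity
  have e : (n : ℝ) * (2 * Real.log C) = Real.log (C ^ (2 * n)) := by
    rw [Real.log_pow]; push_cast; ring
  rw [e]
  refine S9.Ent_le_add_log hp h1 _ _ _ (by positivity) fun x0 => ?_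
  refine ⟨Fintype.piFinset fun q => S9.Mset (pbar P 1) (pbar P (2/3)) (S9.YY P idx (v x0) w q) B B',
    ?_, ?_⟩
  · intro x hx
    rw [Fintype.mem_piFinset]
    intro q
    refine S9.mem_Mset _ _ (S9.one_le_pbar P 1 hP (by norm_num))
      (S9.one_le_pbar P (2/3) hP (by norm_num)) B B' _ _
      (S9.abs_YY P hP idx (v x) w hw (hv x) Δ₂ hΔ hg q)
      (S9.abs_YY_sub P hP idx (v x) (v x0) w Δ₂ hΔ hg q ?_)
    have hq := congrFun hx q.2
    simp only [Prod.mk.injEq] at hq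
    have hQz : (0 : ℤ) < Q := by exact_mod_cast Q1
    have dv : ∀ a b : ℤ, a / Q = b / Q → |a - b| ≤ Q := by
      intro a b hab
      have a1 := Int.emod_add_mul_ediv a Q
      have a2 := Int.emod_add_mul_ediv b Q
      have b1 := Int.emod_nonneg a hQz.ne'
      have b2 := Int.emod_nonneg b hQz.ne'
      have c1 := Int.emod_lt_of_pos a hQz
      have c2 := Int.emod_lt_of_pos b hQz
      rw [hab] at a1
      rw [abs_le]
      constructor <;> linarith
    have m1 := hmem x q.2
    have m2 := hmem x0 q.2
    have m3 := hmem' x q.2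
    have m4 := hmem' x0 q.2
    simp only [S9.VV, S9.Box, Finset.mem_product, Finset.mem_Icc] at m1 m2 m3 m4
    intro i
    fin_cases i
    · simp [S9.e7]
    · simp [S9.e7]
    · exact dv _ _ hq.1
    · exact dv _ _ hq.2
    · have a := m1.2.2.1; have b := m2.2.2.1
      change |S9.e7 P 0 (v x) q.2 4 - S9.e7 P 0 (v x0) q.2 4| ≤ _
      rw [abs_le]; omega
    · have a := m1.2.2.2; have b := m2.2.2.2
      change |S9.e7 P 0 (v x) q.2 5 - S9.e7 P 0 (v x0) q.2 5| ≤ _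
      rw [abs_le]; omega
    · have a := m3.2.2.2; have b := m4.2.2.2
      change |S9.e7 P 0 (v x) q.2 6 - S9.e7 P 0 (v x0) q.2 6| ≤ _
      rw [abs_le]; omega
  · rw [Fintype.card_piFinset]
    push_cast
    have : ∀ q ∈ (Finset.univ : Finset (Fin 2 × Fin n)),
        ((S9.Mset (pbar P 1) (pbar P (2/3)) (S9.YY P idx (v x0) w q) B B').card : ℝ) ≤ C := by
      intro q _
      rw [hC]
      exact_mod_cast S9.card_Mset (pbar P 1) (pbar P (2/3)) (S9.YY P idx (v x0) w q) B B'
    refine (Finset.prod_le_prod (fun _ _ => by positivity) this).trans ?_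
    simp

theorem S9.core (fmax Δ₁ Δ₂ : ℝ) (hf : 0 < fmax) (hΔ : 0 < Δ₂) (P : ℝ) (hP : 2 ≤ P) (n : ℕ)
    (hn : 1 ≤ n) {Ω : Type} [MeasurableSpace Ω] (μ : Measure Ω) [IsProbabilityMeasure μ]
    {ι X : Type} [DecidableEq ι] [Fintype X] (p : X → ℝ) (hp : ∀ x, 0 ≤ p x) (h1 : ∑ x, p x = 1)
    (v : X → Fin 5 × Fin n → ℤ) (hv : ∀ x j, 0 ≤ v x j ∧ v x j ≤ pbar P 1)
    (G : ι → Ω → ℝ) (idx : Fin 2 → Fin n → Fin 7 → ι) (hG : ∀ i, Measurable (G i))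
    (hidx : Function.Injective (fun p : Fin 2 × Fin n × Fin 7 => idx p.1 p.2.1 p.2.2))
    (X1 : Ω → Fin 5 × Fin n → ℤ) (hX1m : Measurable X1)
    (hX1 : ∀ ω j, 0 ≤ X1 ω j ∧ X1 ω j ≤ pbar P 1)
    (hB : BoundedDensityFamily μ G Δ₁ Δ₂ fmax) (A : ℝ)
    (hA : A = fmax ^ 7 * ((8 * ((4 * (⌈7 * Δ₂⌉₊ : ℝ) + 1) * 5) + 2 * Δ₂) * (2 * Δ₂) ^ 6)) (C : ℝ)
    (hC : C = (2 * (⌈7 * Δ₂⌉₊ : ℝ) + 1) * (2 * (⌈28 * (Δ₂ + 2)⌉₊ : ℝ) + 4)) :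
    2 * S9.Ent p (fun x (q : Fin 3 × Fin n) => midPart P (1/2) 1 (v x (q.1.succ.succ, q.2)))
      ≤ 3 * ∫ ω, S9.Ent p (fun x => S9.LM P idx (v x) (X1 ω, fun i => G i ω)) ∂μ
        - ∫ ω, S9.Ent p (fun x => (S9.LM P idx (v x) (X1 ω, fun i => G i ω)).2) ∂μ
        + n * (3 * Real.log (A ^ 2 * (45 * (6 * (1 + Real.log P)) ^ 2)) + 2 * Real.log C) := by
  have hlog : 0 ≤ Real.log P := Real.log_nonneg (by linarith)
  have hA0 : 0 < A := by rw [hA]; positivity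
  obtain ⟨Q1, -⟩ := S9.Q_le P hP
  obtain ⟨lb1, lb2⟩ := S9.log_bounds P hP
  set K : ℝ := A ^ 2 * (45 * (6 * (1 + Real.log P)) ^ 2) with hK
  have hK0 : 0 < K := by positivity
  set W : Ω → (Fin 5 × Fin n → ℤ) × (ι → ℝ) := fun ω => (X1 ω, fun i => G i ω) with hWd
  have hW : Measurable W := hX1m.prodMk (measurable_pi_lambda _ hG)
  have hYm := fun x => S9.measurable_YY P idx (v x)
  have hLM : ∀ x, Measurable (S9.LM P idx (v x)) := by
    intro x
    unfold S9.LM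
    refine Measurable.prodMk ?_ ?_
    · exact measurable_pi_lambda _ fun q =>
        (measurable_of_countable (lowPart P (2/3))).comp ((measurable_pi_apply q).comp (hYm x))
    · exact measurable_pi_lambda _ fun q =>
        (measurable_of_countable (midPart P (2/3) 1)).comp ((measurable_pi_apply q).comp (hYm x))
  have hV : ∀ j1 j2 : Fin 7, 4 ≤ j1 → 4 ≤ j2 →
      S9.Ent p (fun x => S9.VV P (n := n) ⌊2 * P ^ (1/4 : ℝ)⌋₊ j1 j2 (v x))
      ≤ ∫ ω, S9.Ent p (fun x => S9.LM P idx (v x) (W ω)) ∂μ + n * Real.log K := by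
    intro j1 j2 hj1 hj2
    refine S9.Ent_le_prod μ W hW (fun x => S9.LM P idx (v x)) hLM p hp h1 n _
      (S9.Box (pbar P 1).toNat ⌊2 * P ^ (1/4 : ℝ)⌋₊)
      (fun x t => S9.VV_mem P hP j1 j2 hj1 hj2 (v x) (hv x) t)
      (fun a b => A ^ 2 * S9.bk ⌊2 * P ^ (1/4 : ℝ)⌋₊ a b)
      (fun a b => mul_nonneg (sq_nonneg _) (S9.bk_nonneg _ _ _)) ?_ K hK0 ?_
    · intro x y
      rw [hA]
      exact S9.hb_lemma P hP n hn μ G hG Δ₁ Δ₂ fmax hΔ.le hf.le hB idx hidx X1 hX1 j1 j2 (v x) (v y)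
        (hv x) (hv y)
    · intro v' hv'
      rw [← Finset.mul_sum]
      exact mul_le_mul_of_nonneg_left (S9.sum_bk _ _ Q1 _ lb2 lb1 v' hv') (sq_nonneg _)
  have V1 := hV 4 5 (by decide) (by decide)
  have V2 := hV 4 6 (by decide) (by decide)
  have V3 := hV 5 6 (by decide) (by decide)
  set Q := ⌊2 * P ^ (1/4 : ℝ)⌋₊ with hQ
  set DE : X → Fin n → ℤ × ℤ := fun x t => (S9.e7 P 0 (v x) t 2 / (Q : ℤ), S9.e7 P 0 (v x) t 3 / (Q : ℤ))
    with hDE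
  have hM : ∫ ω, S9.Ent p (fun x => (S9.LM P idx (v x) (W ω)).2) ∂μ
      ≤ S9.Ent p DE + n * (2 * Real.log C) := by
    have hae : ∀ᵐ ω ∂μ, ∀ k t i, |G (idx k t i) ω| ≤ Δ₂ := by
      rw [ae_all_iff]; intro k; rw [ae_all_iff]; intro t; rw [ae_all_iff]; intro i
      filter_upwards [hB.1 (idx k t i)] with ω h using h.2
    have : ∫ ω, S9.Ent p (fun x => (S9.LM P idx (v x) (W ω)).2) ∂μ
        ≤ ∫ ω, (S9.Ent p DE + n * (2 * Real.log C)) ∂μ := by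
      refine integral_mono_ae (S9.integrable_Ent μ p W hW (fun x w => (S9.LM P idx (v x) w).2)
        (fun x => measurable_snd.comp (hLM x))) (integrable_const _) ?_
      filter_upwards [hae] with ω hω
      rw [hC]
      exact S9.count_lemma P hP hp h1 v hv idx (W ω) (hX1 ω) Δ₂ hΔ.le hω
    simpa using this
  set z : Fin 7 → X → Fin n → ℤ := fun j x t => S9.e7 P 0 (v x) t j with hz
  have s1 := S9.Ent_submod hp h1 (fun x => (DE x, z 4 x)) (z 5) (z 6)
  have s2 := S9.Ent_submod hp h1 DE (z 4) (fun x => (z 5 x, z 6 x))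
  have ex : ∀ (j1 j2 : Fin 7) (x y : X), S9.VV P (n := n) Q j1 j2 (v y) = S9.VV P Q j1 j2 (v x) →
      DE y = DE x ∧ z j1 y = z j1 x ∧ z j2 y = z j2 x := by
    intro j1 j2 x y h
    refine ⟨?_, ?_, ?_⟩ <;> funext t <;> have := congrFun h t <;>
      simp only [S9.VV, Prod.mk.injEq] at this
    · simp only [hDE, Prod.mk.injEq]; exact ⟨this.1, this.2.1⟩
    · exact this.2.2.1
    · exact this.2.2.2
  have c1 := S9.Ent_mono hp (fun x => S9.VV P (n := n) Q 4 5 (v x)) (fun x => ((DE x, z 4 x), z 5 x))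
    (by intro x y h; obtain ⟨a, b, c⟩ := ex _ _ _ _ h; simp only [a, b, c])
  have c2 := S9.Ent_mono hp (fun x => S9.VV P (n := n) Q 4 6 (v x)) (fun x => ((DE x, z 4 x), z 6 x))
    (by intro x y h; obtain ⟨a, b, c⟩ := ex _ _ _ _ h; simp only [a, b, c])
  have c3 := S9.Ent_mono hp (fun x => S9.VV P (n := n) Q 5 6 (v x)) (fun x => (DE x, z 5 x, z 6 x))
    (by intro x y h; obtain ⟨a, b, c⟩ := ex _ _ _ _ h; simp only [a, b, c])
  have fin : ∀ x y : X, z 4 y = z 4 x → z 5 y = z 5 x → z 6 y = z 6 x →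
      (fun (q : Fin 3 × Fin n) => midPart P (1/2) 1 (v y (q.1.succ.succ, q.2)))
        = (fun (q : Fin 3 × Fin n) => midPart P (1/2) 1 (v x (q.1.succ.succ, q.2))) := by
    intro x y a b c
    funext ⟨i, t⟩
    fin_cases i
    · exact congrFun a t
    · exact congrFun b t
    · exact congrFun c t
  have d1 := S9.Ent_mono hp (fun x => ((DE x, z 4 x), z 5 x, z 6 x))
    (fun x (q : Fin 3 × Fin n) => midPart P (1/2) 1 (v x (q.1.succ.succ, q.2)))
    (by intro x y h; simp only [Prod.mk.injEq] at h; exact fin x y h.1.2 h.2.1 h.2.2)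
  have d2 := S9.Ent_mono hp (fun x => (DE x, z 4 x, z 5 x, z 6 x))
    (fun x (q : Fin 3 × Fin n) => midPart P (1/2) 1 (v x (q.1.succ.succ, q.2)))
    (by intro x y h; simp only [Prod.mk.injEq] at h; exact fin x y h.2.1 h.2.2.1 h.2.2.2)
  nlinarith [V1, V2, V3, hM, s1, s2, c1, c2, c3, d1, d2]

theorem S9.indep_rearrange {Ω A B C : Type*} [MeasurableSpace Ω] [MeasurableSpace A]
    [MeasurableSpace B] [MeasurableSpace C] (μ : Measure Ω) [IsProbabilityMeasure μ]
    (f : Ω → A) (g : Ω → B) (h : Ω → C) (hf : Measurable f) (hg : Measurable g) (hh : Measurable h)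
    (h1 : IndepFun f g μ) (h2 : IndepFun (fun ω => (f ω, g ω)) h μ) :
    IndepFun g (fun ω => (f ω, h ω)) μ := by
  have h3 : IndepFun f h μ := h2.comp measurable_fst measurable_id
  rw [indepFun_iff_map_prod_eq_prod_map_map (by fun_prop) (by fun_prop)] at *
  have : IsProbabilityMeasure (μ.map f) := Measure.isProbabilityMeasure_map hf.aemeasurable
  have : IsProbabilityMeasure (μ.map g) := Measure.isProbabilityMeasure_map hg.aemeasurable
  have : IsProbabilityMeasure (μ.map h) := Measure.isProbabilityMeasure_map hh.aemeasurable
  rw [h3, ← Measure.prodAssoc_prod, ← Measure.prod_swap (μ := μ.map f) (ν := μ.map g), ← h1]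
  have e : (μ.map (fun ω => (f ω, g ω))).map Prod.swap = μ.map (fun ω => (g ω, f ω)) := by
    rw [Measure.map_map (by fun_prop) (by fun_prop)]; rfl
  have e2 : ((μ.map (fun ω => (f ω, g ω))).map Prod.swap).prod (μ.map h)
      = μ.map (fun ω => ((g ω, f ω), h ω)) := by
    have := Measure.map_prod_map (μ.map (fun ω => (f ω, g ω))) (μ.map h)
      (f := Prod.swap) (g := id) measurable_swap measurable_id
    rw [Measure.map_id] at this
    rw [this, ← h2, Measure.map_map (by fun_prop) (by fun_prop)]
    rfl
  rw [e2, Measure.map_map (by fun_prop) (by fun_prop)]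
  rfl

open MeasureTheory ProbabilityTheory in
theorem stmt_9 (fmax Δ₁ Δ₂ : ℝ) (hfmax : 0 < fmax) (hΔ₁ : 0 < Δ₁) (hΔ₁₂ : Δ₁ ≤ Δ₂) :
    ∃ c : ℝ, 0 < c ∧
      ∀ (P : ℝ), 2 ≤ P → ∀ (n : ℕ), 1 ≤ n →
      ∀ (Ω : Type) [MeasurableSpace Ω] (μ : Measure Ω) [IsProbabilityMeasure μ]
        (X1 X2 : Fin 5 → Fin n → Ω → ℤ)
        (ι : Type) [DecidableEq ι] (G : ι → Ω → ℝ) (idx : Fin 2 → Fin n → Fin 7 → ι),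
        (∀ m t, Measurable (X1 m t)) → (∀ m t, Measurable (X2 m t)) →
        (∀ i, Measurable (G i)) →
        Function.Injective (fun p : Fin 2 × Fin n × Fin 7 => idx p.1 p.2.1 p.2.2) →
        (∀ m t ω, 0 ≤ X1 m t ω ∧ X1 m t ω ≤ pbar P 1) →
        (∀ m t ω, 0 ≤ X2 m t ω ∧ X2 m t ω ≤ pbar P 1) →
        IndepFun (fun ω (q : Fin 5 × Fin n) => X1 q.1 q.2 ω)
          (fun ω (q : Fin 5 × Fin n) => X2 q.1 q.2 ω) μ →
        IndepFun
          (fun ω => ((fun q : Fin 5 × Fin n => X1 q.1 q.2 ω),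
                     (fun q : Fin 5 × Fin n => X2 q.1 q.2 ω)))
          (fun ω (i : ι) => G i ω) μ →
        BoundedDensityFamily μ G Δ₁ Δ₂ fmax →
        (letI Y : Fin 2 → Fin n → Ω → ℤ := fun k t ω =>
          truncZ (G (idx k t 0) ω * (X1 3 t ω : ℝ)) +
          truncZ (G (idx k t 1) ω * (X1 4 t ω : ℝ)) +
          truncZ (G (idx k t 2) ω * (midPart P (1/4) 1 (X2 0 t ω) : ℝ)) +
          truncZ (G (idx k t 3) ω * (midPart P (1/4) 1 (X2 1 t ω) : ℝ)) +
          truncZ (G (idx k t 4) ω * (midPart P (1/2) 1 (X2 2 t ω) : ℝ)) +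
          truncZ (G (idx k t 5) ω * (midPart P (1/2) 1 (X2 3 t ω) : ℝ)) +
          truncZ (G (idx k t 6) ω * (midPart P (1/2) 1 (X2 4 t ω) : ℝ))
        2 * shEntropy μ
            (fun ω (q : Fin 3 × Fin n) => midPart P (1/2) 1 (X2 q.1.succ.succ q.2 ω))
          ≤ 2 * shCondEntropy μ (fun ω (q : Fin 2 × Fin n) => Y q.1 q.2 ω)
              (fun ω => ((fun q : Fin 5 × Fin n => X1 q.1 q.2 ω), fun i : ι => G i ω))
            + shCondEntropy μ
                (fun ω (q : Fin 2 × Fin n) => lowPart P (2/3) (Y q.1 q.2 ω))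
                (fun ω => ((fun q : Fin 2 × Fin n => midPart P (2/3) 1 (Y q.1 q.2 ω)),
                           (fun q : Fin 5 × Fin n => X1 q.1 q.2 ω),
                           fun i : ι => G i ω))
            + n * c * (1 + Real.log (1 + Real.log P))) := by
  have hΔ₂ : 0 < Δ₂ := by linarith
  set A : ℝ := fmax ^ 7 * ((8 * ((4 * (⌈7 * Δ₂⌉₊ : ℝ) + 1) * 5) + 2 * Δ₂) * (2 * Δ₂) ^ 6) with hA
  set C : ℝ := (2 * (⌈7 * Δ₂⌉₊ : ℝ) + 1) * (2 * (⌈28 * (Δ₂ + 2)⌉₊ : ℝ) + 4) with hC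
  have hA0 : 0 < A := by positivity
  refine ⟨3 * (|Real.log (A ^ 2 * 1620)| + 2) + 2 * |Real.log C|, by positivity, ?_⟩
  intro P hP n hn Ω _ μ _ X1 X2 ι _ G idx hX1m hX2m hGm hidx hX1 hX2 hI12 hIG hB
  set Y : Fin 2 → Fin n → Ω → ℤ := fun k t ω =>
          truncZ (G (idx k t 0) ω * (X1 3 t ω : ℝ)) +
          truncZ (G (idx k t 1) ω * (X1 4 t ω : ℝ)) +
          truncZ (G (idx k t 2) ω * (midPart P (1/4) 1 (X2 0 t ω) : ℝ)) +
          truncZ (G (idx k t 3) ω * (midPart P (1/4) 1 (X2 1 t ω) : ℝ)) +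
          truncZ (G (idx k t 4) ω * (midPart P (1/2) 1 (X2 2 t ω) : ℝ)) +
          truncZ (G (idx k t 5) ω * (midPart P (1/2) 1 (X2 3 t ω) : ℝ)) +
          truncZ (G (idx k t 6) ω * (midPart P (1/2) 1 (X2 4 t ω) : ℝ)) with hYd
  set S : Finset (Fin 5 × Fin n → ℤ) :=
    Fintype.piFinset (fun _ : Fin 5 × Fin n => Finset.Icc 0 (pbar P 1)) with hS
  have hX1v : Measurable (fun ω (q : Fin 5 × Fin n) => X1 q.1 q.2 ω) :=
    measurable_pi_lambda _ fun q => hX1m _ _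
  have hX2v : Measurable (fun ω (q : Fin 5 × Fin n) => X2 q.1 q.2 ω) :=
    measurable_pi_lambda _ fun q => hX2m _ _
  have hGv : Measurable (fun ω (i : ι) => G i ω) := measurable_pi_lambda _ hGm
  have hmemS : ∀ ω, (fun q : Fin 5 × Fin n => X2 q.1 q.2 ω) ∈ S := fun ω => by
    rw [hS, Fintype.mem_piFinset]
    intro q
    exact Finset.mem_Icc.2 (hX2 _ _ _)
  set V : Ω → S := fun ω => ⟨fun q => X2 q.1 q.2 ω, hmemS ω⟩ with hVd
  have hVm : Measurable V := hX2v.subtype_mk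
  set W : Ω → (Fin 5 × Fin n → ℤ) × (ι → ℝ) :=
    fun ω => ((fun q => X1 q.1 q.2 ω), fun i => G i ω) with hWd
  have hWm : Measurable W := hX1v.prodMk hGv
  have hI2 := S9.indep_rearrange μ _ _ _ hX1v hX2v hGv hI12 hIG
  have hI : IndepFun V W μ := by
    rw [IndepFun_iff] at hI2 ⊢
    intro s t hs ht
    refine hI2 s t ?_ ht
    obtain ⟨s', ⟨s'', hs'', rfl⟩, rfl⟩ := hs
    exact ⟨s'', hs'', rfl⟩
  set p : S → ℝ := fun x => μ.real (V ⁻¹' {x}) with hp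
  have hp0 : ∀ x, 0 ≤ p x := fun x => measureReal_nonneg
  have hp1 : ∑ x, p x = 1 := S9.sum_law μ V hVm
  set v : S → Fin 5 × Fin n → ℤ := fun x => x.1 with hv
  have hvb : ∀ x j, 0 ≤ v x j ∧ v x j ≤ pbar P 1 := fun x j => by
    exact Finset.mem_Icc.1 (Fintype.mem_piFinset.1 x.2 j)
  have hY : ∀ ω, (fun q : Fin 2 × Fin n => Y q.1 q.2 ω) = S9.YY P idx (v (V ω)) (W ω) := by
    intro ω
    funext q
    unfold S9.YY
    rw [Fin.sum_univ_seven]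
    rfl
  have hYm := fun x => S9.measurable_YY P idx (v x)
  have hlm : ∀ x, Measurable (fun w => fun q => lowPart P (2/3) (S9.YY P idx (v x) w q)) :=
    fun x => measurable_pi_lambda _ fun q =>
        (measurable_of_countable (lowPart P (2/3))).comp ((measurable_pi_apply q).comp (hYm x))
  have hmm : ∀ x, Measurable (fun w => fun q => midPart P (2/3) 1 (S9.YY P idx (v x) w q)) :=
    fun x => measurable_pi_lambda _ fun q =>
        (measurable_of_countable (midPart P (2/3) 1)).comp ((measurable_pi_apply q).comp (hYm x))
  have hLM : ∀ x, Measurable (S9.LM P idx (v x)) := fun x => (hlm x).prodMk (hmm x)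
  have e0 : shEntropy μ
      (fun ω (q : Fin 3 × Fin n) => midPart P (1/2) 1 (X2 q.1.succ.succ q.2 ω))
      = S9.Ent p (fun x (q : Fin 3 × Fin n) => midPart P (1/2) 1 (v x (q.1.succ.succ, q.2))) :=
    S9.shEntropy_eq μ V hVm
      (fun x (q : Fin 3 × Fin n) => midPart P (1/2) 1 (v x (q.1.succ.succ, q.2)))
  have e1 : shCondEntropy μ (fun ω (q : Fin 2 × Fin n) => Y q.1 q.2 ω) W
      = ∫ ω, S9.Ent p (fun x => (S9.YY P idx (v x) (W ω), ())) ∂μ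
        - ∫ ω, S9.Ent p (fun _ => ()) ∂μ := by
    have := S9.shCondEntropy_eq μ V W hVm hWm hI (fun x w => S9.YY P idx (v x) w) hYm
      (fun _ _ => ()) (fun _ => measurable_const) W (by
        refine le_antisymm ?_ ?_
        · have : W = Prod.snd ∘ (fun ω => ((), W ω)) := rfl
          conv_lhs => rw [this, ← MeasurableSpace.comap_comp]
          exact MeasurableSpace.comap_mono measurable_snd.comap_le
        · have : (fun ω => ((), W ω)) = (fun w => ((), w)) ∘ W := rfl
          rw [this, ← MeasurableSpace.comap_comp]
          exact MeasurableSpace.comap_mono (measurable_const.prodMk measurable_id).comap_le)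
    rw [← this]
    congr 1
    funext ω
    exact hY ω
  have e2 : shCondEntropy μ
                (fun ω (q : Fin 2 × Fin n) => lowPart P (2/3) (Y q.1 q.2 ω))
                (fun ω => ((fun q : Fin 2 × Fin n => midPart P (2/3) 1 (Y q.1 q.2 ω)),
                           (fun q : Fin 5 × Fin n => X1 q.1 q.2 ω),
                           fun i : ι => G i ω))
      = ∫ ω, S9.Ent p (fun x => S9.LM P idx (v x) (W ω)) ∂μ
        - ∫ ω, S9.Ent p (fun x => (S9.LM P idx (v x) (W ω)).2) ∂μ := by
    have := S9.shCondEntropy_eq μ V W hVm hWm hI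
      (fun x w q => lowPart P (2/3) (S9.YY P idx (v x) w q)) hlm
      (fun x w q => midPart P (2/3) 1 (S9.YY P idx (v x) w q)) hmm _ rfl
    refine Eq.trans ?_ this
    congr 1
    · funext ω q
      exact congrArg _ (congrFun (hY ω) q)
    · funext ω
      refine Prod.ext ?_ rfl
      funext q
      exact congrArg (midPart P (2/3) 1) (congrFun (hY ω) q)
  have e3 : ∫ ω, S9.Ent p (fun x => S9.LM P idx (v x) (W ω)) ∂μ
      ≤ ∫ ω, S9.Ent p (fun x => (S9.YY P idx (v x) (W ω), ())) ∂μ := by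
    refine integral_mono (S9.integrable_Ent μ p W hWm (fun x => S9.LM P idx (v x)) hLM)
      (S9.integrable_Ent μ p W hWm (fun x w => (S9.YY P idx (v x) w, ()))
        (fun x => (hYm x).prodMk measurable_const)) fun ω => ?_
    refine S9.Ent_mono hp0 _ _ fun x y h => ?_
    simp only [Prod.mk.injEq, and_true] at h
    unfold S9.LM
    rw [h]
  have e4 : ∫ ω, S9.Ent p (fun _ => ()) ∂μ = 0 := by
    simp [S9.Ent_const hp1]
  have core := S9.core fmax Δ₁ Δ₂ hfmax hΔ₂ P hP n hn μ p hp0 hp1 v hvb G idx hGm hidx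
    (fun ω (q : Fin 5 × Fin n) => X1 q.1 q.2 ω) hX1v (fun ω j => hX1 _ _ _) hB A hA C hC
  have hL : 0 ≤ Real.log P := Real.log_nonneg (by linarith)
  have hLL : 0 ≤ Real.log (1 + Real.log P) := Real.log_nonneg (by linarith)
  have hlogK : Real.log (A ^ 2 * (45 * (6 * (1 + Real.log P)) ^ 2))
      = Real.log (A ^ 2 * 1620) + 2 * Real.log (1 + Real.log P) := by
    rw [show A ^ 2 * (45 * (6 * (1 + Real.log P)) ^ 2) = A ^ 2 * 1620 * (1 + Real.log P) ^ 2 by ring,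
      Real.log_mul (by positivity) (by positivity), Real.log_pow]
    norm_num
  have hfin : 3 * Real.log (A ^ 2 * (45 * (6 * (1 + Real.log P)) ^ 2)) + 2 * Real.log C
      ≤ (3 * (|Real.log (A ^ 2 * 1620)| + 2) + 2 * |Real.log C|) * (1 + Real.log (1 + Real.log P)) := by
    rw [hlogK]
    have a1 := le_abs_self (Real.log (A ^ 2 * 1620))
    have a2 := le_abs_self (Real.log C)
    have b1 := mul_nonneg (abs_nonneg (Real.log (A ^ 2 * 1620))) hLL
    have b2 := mul_nonneg (abs_nonneg (Real.log C)) hLL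
    nlinarith
  have hfin' := mul_le_mul_of_nonneg_left hfin (Nat.cast_nonneg n : (0 : ℝ) ≤ n)
  have e1' := e1
  rw [e4, sub_zero] at e1'
  rw [e0, e2]
  change _ ≤ 2 * shCondEntropy μ (fun ω (q : Fin 2 × Fin n) => Y q.1 q.2 ω) W + _ + _
  rw [e1']
  rw [mul_assoc (n : ℝ)]
  change _ ≤ 3 * ∫ ω, S9.Ent p (fun x => S9.LM P idx (v x) (W ω)) ∂μ
    - ∫ ω, S9.Ent p (fun x => (S9.LM P idx (v x) (W ω)).2) ∂μ + _ at core
  linarith [core, e3, hfin']
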